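/- arXiv:0805.1622 — 6 statements merged into one kernel-verified Lean document; each statement's English description precedes it below -/
import Mathlib

section
/- Let m, p, k ≥ 1 be integers and let n ≥ mpk + 1. The number of k-element subsets S of the cyclic group Z_n such that for every ordered pair (x, y) of distinct elements of S the difference x − y (computed modulo n) does not lie in {m, 2m, …, pm} (taken modulo n) is equal to (n/(n − pk)) · C(n − pk, k), and in particular is independent of m. -/
open Finset Polynomial in
/-- Rothe coefficients. -/
noncomputable def rotheA (p : ℕ) : ℕ → ℚ → ℚ
  | 0, _ => 1
  | j + 1, x => x / (j + 1).factorial * (descPochhammer ℚ j).eval (x - p * (j + 1) - 1)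

open Polynomial in
lemma rotheA_diff (p j : ℕ) (x : ℚ) :
    rotheA p (j + 1) x = rotheA p (j + 1) (x - 1) + rotheA p j (x - 1 - p) := by
  cases j with
  | zero => simp [rotheA]
  | succ i =>
    have hf : ((i + 1).factorial : ℚ) ≠ 0 := by positivity
    have h1 : (descPochhammer ℚ (i + 1)).eval (x - p * ((i + 1 : ℕ) + 1) - 1) =
        (x - p * (i + 2) - 1) * (descPochhammer ℚ i).eval (x - p * (i + 2) - 2) := by
      rw [descPochhammer_succ_left]
      simp only [eval_mul, eval_X, eval_comp, eval_sub, eval_one]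
      push_cast
      ring_nf
    have h2 : (descPochhammer ℚ (i + 1)).eval (x - 1 - p * ((i + 1 : ℕ) + 1) - 1) =
        (descPochhammer ℚ i).eval (x - p * (i + 2) - 2) * (x - p * (i + 2) - 2 - i) := by
      rw [descPochhammer_succ_right]
      simp only [eval_mul, eval_X, eval_sub, eval_natCast]
      push_cast
      ring_nf
    have h3 : x - 1 - p - p * ((i : ℚ) + 1) - 1 = x - p * (i + 2) - 2 := by ring
    simp only [rotheA]
    rw [h1, h2, h3, Nat.factorial_succ (i + 1)]
    have h4 : ((i : ℚ) + 2) ≠ 0 := by positivity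
    push_cast
    rw [show (i : ℚ) + 1 + 1 = i + 2 by ring]
    field_simp
    ring

open Finset in
lemma rothe (p k : ℕ) : ∀ (x : ℤ) (y : ℚ),
    ∑ ij ∈ antidiagonal k, rotheA p ij.1 x * rotheA p ij.2 y = rotheA p k (x + y) := by
  induction k with
  | zero => intro x y; simp [rotheA]
  | succ k ih =>
    intro x y
    have step : ∀ x : ℤ,
        (∑ ij ∈ antidiagonal (k + 1), rotheA p ij.1 x * rotheA p ij.2 y
          - rotheA p (k + 1) (x + y)) =
        (∑ ij ∈ antidiagonal (k + 1), rotheA p ij.1 ((x - 1 : ℤ) : ℚ) * rotheA p ij.2 y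
          - rotheA p (k + 1) (((x - 1 : ℤ) : ℚ) + y)) := by
      intro x
      rw [Nat.sum_antidiagonal_succ, Nat.sum_antidiagonal_succ]
      have h := ih (x - 1 - p) y
      have h0 := rotheA_diff p k (x + y)
      simp only [rotheA_diff p _ (x : ℚ), add_mul, sum_add_distrib]
      push_cast at h ⊢
      rw [h, h0]
      have e1 : (x : ℚ) - 1 - p + y = x + y - 1 - p := by ring
      have e2 : (x : ℚ) - 1 + y = x + y - 1 := by ring
      rw [e1, e2]
      simp only [rotheA]
      ring
    have key : ∀ x : ℤ,
        (∑ ij ∈ antidiagonal (k + 1), rotheA p ij.1 x * rotheA p ij.2 y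
          - rotheA p (k + 1) (x + y)) = 0 := by
      intro x
      induction x using Int.induction_on with
      | zero =>
        rw [Nat.sum_antidiagonal_succ]
        simp [rotheA]
      | succ i hi => rw [step, add_sub_cancel_right]; exact hi
      | pred i hi => rw [step] at hi; exact hi
    linarith [key x]

lemma rotheA_nat (p j L : ℕ) (h : p * (j + 1) + 1 ≤ L) :
    ((j : ℚ) + 1) * rotheA p (j + 1) L = L * ((L - 1 - p * (j + 1)).choose j : ℕ) := by
  have e : (L : ℚ) - p * (j + 1) - 1 = ((L - 1 - p * (j + 1) : ℕ) : ℚ) := by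
    rw [Nat.sub_sub, Nat.cast_sub (by omega)]; push_cast; ring
  simp only [rotheA]
  rw [e, descPochhammer_eval_eq_descFactorial, Nat.descFactorial_eq_factorial_mul_choose,
    Nat.factorial_succ]
  have hf : ((j).factorial : ℚ) ≠ 0 := by positivity
  push_cast
  field_simp

lemma rotheA_final (p k n : ℕ) (hk : 1 ≤ k) (h : p * k + 1 ≤ n) :
    rotheA p k n = (n : ℚ) / ((n - p * k : ℕ) : ℚ) * ((n - p * k).choose k : ℚ) := by
  obtain ⟨j, rfl⟩ : ∃ j, k = j + 1 := ⟨k - 1, by omega⟩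
  have h1 := rotheA_nat p j n h
  obtain ⟨N, hN⟩ : ∃ N, n - p * (j + 1) = N + 1 := ⟨n - p * (j + 1) - 1, by omega⟩
  have hN' : n - 1 - p * (j + 1) = N := by omega
  rw [hN'] at h1
  rw [hN]
  have h2 := Nat.add_one_mul_choose_eq N j
  have h3 : ((N : ℚ) + 1) * N.choose j = (N + 1).choose (j + 1) * (j + 1) := by exact_mod_cast h2
  have : (N : ℚ) + 1 ≠ 0 := by positivity
  have hj : (j : ℚ) + 1 ≠ 0 := by positivity
  push_cast
  field_simp
  apply mul_left_cancel₀ hj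
  linear_combination ((N : ℚ) + 1) * h1 + n * h3

/-- Subsets of an initial segment with all gaps larger than `p`. -/
def linSets (p n k : ℕ) : Finset (Finset ℕ) :=
  {S ∈ (Finset.range n).powerset | S.card = k ∧ ∀ x ∈ S, ∀ y ∈ S, x < y → x + p < y}

lemma mem_linSets {p n k : ℕ} {S : Finset ℕ} : S ∈ linSets p n k ↔
    (∀ x ∈ S, x < n) ∧ S.card = k ∧ ∀ x ∈ S, ∀ y ∈ S, x < y → x + p < y := by
  simp [linSets, Finset.subset_iff]

lemma linSets_succ (p n k : ℕ) : linSets p (n + 1) (k + 1) =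
    linSets p n (k + 1) ∪ (linSets p (n - p) k).image (insert n) := by
  ext S
  simp only [Finset.mem_union, Finset.mem_image, mem_linSets]
  constructor
  · rintro ⟨h1, h2, h3⟩
    by_cases hS : n ∈ S
    · right
      refine ⟨S.erase n, ⟨?_, ?_, ?_⟩, Finset.insert_erase hS⟩
      · intro x hx
        have hx' := Finset.mem_erase.1 hx
        have := h1 x hx'.2
        have := h3 x hx'.2 n hS (by omega)
        omega
      · rw [Finset.card_erase_of_mem hS]; omega
      · intro x hx y hy
        exact h3 x (Finset.mem_of_mem_erase hx) y (Finset.mem_of_mem_erase hy)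
    · left
      refine ⟨fun x hx => ?_, h2, h3⟩
      have := h1 x hx
      have : x ≠ n := fun h => hS (h ▸ hx)
      omega
  · rintro (⟨h1, h2, h3⟩ | ⟨T, ⟨h1, h2, h3⟩, rfl⟩)
    · exact ⟨fun x hx => by have := h1 x hx; omega, h2, h3⟩
    · have hn : n ∉ T := fun h => by have := h1 n h; omega
      refine ⟨?_, by rw [Finset.card_insert_of_notMem hn, h2], ?_⟩
      · intro x hx
        rcases Finset.mem_insert.1 hx with rfl | hx
        · omega
        · have := h1 x hx; omega
      · intro x hx y hy hxy
        rcases Finset.mem_insert.1 hx with hx1 | hx1 <;>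
        rcases Finset.mem_insert.1 hy with hy1 | hy1
        · omega
        · have := h1 y hy1; omega
        · have := h1 x hx1; omega
        · exact h3 x hx1 y hy1 hxy

lemma card_linSets (p n : ℕ) : ∀ k, (linSets p n k).card = (n + p - p * k).choose k := by
  induction n using Nat.strong_induction_on with
  | _ n ih =>
  intro k
  cases k with
  | zero =>
    have : linSets p n 0 = {∅} := by
      ext S
      simp only [mem_linSets, Finset.mem_singleton, Finset.card_eq_zero]
      constructor
      · exact fun h => h.2.1
      · rintro rfl; simp
    simp [this]
  | succ k =>
  cases n with
  | zero =>
    have : linSets p 0 (k + 1) = ∅ := by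
      ext S
      simp only [mem_linSets, Finset.notMem_empty, iff_false]
      rintro ⟨h1, h2, -⟩
      obtain ⟨x, hx⟩ := Finset.card_pos.1 (by omega : 0 < S.card)
      exact absurd (h1 x hx) (by omega)
    have h0 : 0 + p - p * (k + 1) = 0 := by rw [mul_add]; omega
    rw [this, h0]; simp
  | succ n =>
    rw [linSets_succ, Finset.card_union_of_disjoint, Finset.card_image_of_injOn,
      ih n (by omega), ih (n - p) (by omega)]
    · rw [mul_add, mul_one]
      by_cases hnk : n < p * k
      · have hk : k ≠ 0 := by rintro rfl; simp at hnk
        have hpk : p ≤ p * k := Nat.le_mul_of_pos_right p (by omega)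
        have e1 : n + p - (p * k + p) = 0 := by omega
        have e2 : n - p + p - p * k = 0 := by omega
        have e3 : n + 1 + p - (p * k + p) = 0 := by omega
        rw [e1, e2, e3]
        obtain ⟨j, rfl⟩ : ∃ j, k = j + 1 := ⟨k - 1, by omega⟩
        simp
      · by_cases hnp : n < p
        · have hk : k = 0 := by
            by_contra hk
            have hpk : p ≤ p * k := Nat.le_mul_of_pos_right p (by omega)
            omega
          subst hk
          simp
        · have e2 : n - p + p - p * k = n - p * k := by omega
          have e1 : n + p - (p * k + p) = n - p * k := by omega
          have e3 : n + 1 + p - (p * k + p) = n - p * k + 1 := by omega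
          rw [e1, e2, e3, Nat.choose_succ_succ, add_comm]
    · intro S hS T hT hST
      have hn : ∀ S ∈ linSets p (n - p) k, n ∉ S := fun S hS h => by
        have := (mem_linSets.1 hS).1 n h; omega
      rw [← Finset.erase_insert (hn S hS), ← Finset.erase_insert (hn T hT), hST]
    · rw [Finset.disjoint_left]
      intro S hS hS'
      obtain ⟨T, -, rfl⟩ := Finset.mem_image.1 hS'
      have := (mem_linSets.1 hS).1 n (Finset.mem_insert_self _ _)
      omega

/-- Cyclic good sets. -/
def CycGood (p L : ℕ) (S : Finset (ZMod L)) : Prop :=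
  ∀ x ∈ S, ∀ y ∈ S, x ≠ y → ∀ a : ℕ, 1 ≤ a → a ≤ p → x - y ≠ (a : ZMod L)

lemma zmod_cast_inj {L a b : ℕ} (ha : a < L) (hb : b < L) (h : (a : ZMod L) = b) : a = b := by
  have := (ZMod.natCast_eq_natCast_iff' a b L).1 h
  rwa [Nat.mod_eq_of_lt ha, Nat.mod_eq_of_lt hb] at this

open Classical in
lemma card_cyc_mem (p L j : ℕ) [NeZero L] (hL : p + 1 ≤ L) (x : ZMod L) :
    ({S : Finset (ZMod L) | CycGood p L S ∧ S.card = j + 1 ∧ x ∈ S} : Finset _).card =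
      (linSets p (L - 1 - 2 * p) j).card := by
  symm
  have hx : ∀ T ∈ linSets p (L - 1 - 2 * p) j,
      x ∉ T.image (fun t : ℕ => x + ((p + 1 + t : ℕ) : ZMod L)) := by
    intro T hT h
    obtain ⟨t, ht, h⟩ := Finset.mem_image.1 h
    have h1 := (mem_linSets.1 hT).1 t ht
    have : ((p + 1 + t : ℕ) : ZMod L) = (0 : ℕ) := by
      rw [Nat.cast_zero]; exact add_eq_left.1 h
    have := zmod_cast_inj (by omega) (by omega) this
    omega
  have hinj : ∀ t s : ℕ, t < L - 1 - 2 * p → s < L - 1 - 2 * p →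
      x + ((p + 1 + t : ℕ) : ZMod L) = x + ((p + 1 + s : ℕ) : ZMod L) → t = s := by
    intro t s ht hs h
    have := zmod_cast_inj (by omega) (by omega) (add_left_cancel h)
    omega
  refine Finset.card_bij
    (fun T _ => insert x (T.image (fun t : ℕ => x + ((p + 1 + t : ℕ) : ZMod L)))) ?_ ?_ ?_
  · intro T hT
    obtain ⟨h1, h2, h3⟩ := mem_linSets.1 hT
    rw [Finset.mem_filter]
    refine ⟨Finset.mem_univ _, ?_, ?_, Finset.mem_insert_self _ _⟩
    · intro u hu v hv huv a ha hap hd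
      rcases Finset.mem_insert.1 hu with rfl | hu <;>
      rcases Finset.mem_insert.1 hv with rfl | hv
      · exact huv rfl
      · obtain ⟨t, ht, rfl⟩ := Finset.mem_image.1 hv
        have := h1 t ht
        have h0 : ((p + 1 + t + a : ℕ) : ZMod L) = (0 : ℕ) := by
          push_cast at hd ⊢; rw [← hd]; ring
        have := zmod_cast_inj (by omega) (by omega) h0
        omega
      · obtain ⟨t, ht, rfl⟩ := Finset.mem_image.1 hu
        have := h1 t ht
        rw [add_sub_cancel_left] at hd
        have := zmod_cast_inj (by omega) (by omega) hd
        omega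
      · obtain ⟨t, ht, rfl⟩ := Finset.mem_image.1 hu
        obtain ⟨s, hs, rfl⟩ := Finset.mem_image.1 hv
        have := h1 t ht
        have := h1 s hs
        have h0 : ((p + 1 + t : ℕ) : ZMod L) = (p + 1 + s + a : ℕ) := by
          push_cast at hd ⊢; rw [← hd]; ring
        have := zmod_cast_inj (by omega) (by omega) h0
        have := h3 s hs t ht (by omega)
        omega
    · rw [Finset.card_insert_of_notMem (hx T hT), Finset.card_image_of_injOn, h2]
      intro t ht s hs h
      exact hinj t s (h1 t ht) (h1 s hs) h
  · intro T hT T' hT' h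
    have h' : T.image (fun t : ℕ => x + ((p + 1 + t : ℕ) : ZMod L)) =
        T'.image (fun t : ℕ => x + ((p + 1 + t : ℕ) : ZMod L)) := by
      rw [← Finset.erase_insert (hx T hT), ← Finset.erase_insert (hx T' hT'), h]
    have aux : ∀ T ∈ linSets p (L - 1 - 2 * p) j, ∀ T' ∈ linSets p (L - 1 - 2 * p) j,
        T.image (fun t : ℕ => x + ((p + 1 + t : ℕ) : ZMod L)) =
        T'.image (fun t : ℕ => x + ((p + 1 + t : ℕ) : ZMod L)) → T ⊆ T' := by
      intro T hT T' hT' h t ht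
      have : x + ((p + 1 + t : ℕ) : ZMod L) ∈
          T'.image (fun t : ℕ => x + ((p + 1 + t : ℕ) : ZMod L)) :=
        h ▸ Finset.mem_image_of_mem _ ht
      obtain ⟨s, hs, hst⟩ := Finset.mem_image.1 this
      rw [← hinj s t ((mem_linSets.1 hT').1 s hs) ((mem_linSets.1 hT).1 t ht) hst]
      exact hs
    exact Finset.Subset.antisymm (aux T hT T' hT' h') (aux T' hT' T hT h'.symm)
  · intro S hS
    obtain ⟨-, hg, hc, hxS⟩ := Finset.mem_filter.1 hS
    have himg : insert x ((Finset.range (L - 1 - 2 * p)).filter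
        (fun t : ℕ => x + ((p + 1 + t : ℕ) : ZMod L) ∈ S) |>.image
        (fun t : ℕ => x + ((p + 1 + t : ℕ) : ZMod L))) = S := by
      ext z
      constructor
      · intro hz
        rcases Finset.mem_insert.1 hz with rfl | hz
        · exact hxS
        · obtain ⟨t, ht, rfl⟩ := Finset.mem_image.1 hz
          exact (Finset.mem_filter.1 ht).2
      · intro hz
        by_cases hzx : z = x
        · subst hzx; exact Finset.mem_insert_self _ _
        · apply Finset.mem_insert_of_mem
          have hu : (((z - x).val : ℕ) : ZMod L) = z - x := ZMod.natCast_zmod_val _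
          have hlt := ZMod.val_lt (z - x)
          have h0 : (z - x).val ≠ 0 := by
            rw [Ne, ZMod.val_eq_zero]; exact sub_ne_zero.2 hzx
          set u := (z - x).val
          have h1 : p < u := by
            by_contra hcon
            exact hg z hz x hxS hzx u (by omega) (by omega) hu.symm
          have h2 : p < L - u := by
            by_contra hcon
            apply hg x hxS z hz (Ne.symm hzx) (L - u) (by omega) (by omega)
            rw [Nat.cast_sub hlt.le, hu]; simp
          have h3 : x + ((p + 1 + (u - p - 1) : ℕ) : ZMod L) = z := by
            rw [show p + 1 + (u - p - 1) = u by omega, hu]; ring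
          refine Finset.mem_image.2 ⟨u - p - 1, Finset.mem_filter.2 ⟨?_, ?_⟩, h3⟩
          · rw [Finset.mem_range]; omega
          · rw [h3]; exact hz
    refine ⟨_, ?_, himg⟩
    have hlt : ∀ t ∈ (Finset.range (L - 1 - 2 * p)).filter
        (fun t : ℕ => x + ((p + 1 + t : ℕ) : ZMod L) ∈ S), t < L - 1 - 2 * p := by
      intro t ht
      exact Finset.mem_range.1 (Finset.mem_filter.1 ht).1
    rw [mem_linSets]
    refine ⟨hlt, ?_, ?_⟩
    · rw [← himg, Finset.card_insert_of_notMem, Finset.card_image_of_injOn] at hc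
      · omega
      · intro t ht s hs h
        exact hinj t s (hlt t ht) (hlt s hs) h
      · intro h
        obtain ⟨t, ht, h⟩ := Finset.mem_image.1 h
        have h1 := hlt t ht
        have : ((p + 1 + t : ℕ) : ZMod L) = (0 : ℕ) := by
          rw [Nat.cast_zero]; exact add_eq_left.1 h
        have := zmod_cast_inj (by omega) (by omega) this
        omega
    · intro t ht s hs hts
      by_contra hcon
      have h1 := hlt t ht
      have h2 := hlt s hs
      apply hg _ (Finset.mem_filter.1 hs).2 _ (Finset.mem_filter.1 ht).2 _ (s - t)
        (by omega) (by omega)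
      · rw [Nat.cast_sub hts.le]; push_cast; ring
      · intro h
        have := hinj s t h2 h1 h
        omega

open Classical in
lemma card_cyc (p L j : ℕ) [NeZero L] (hL : p * j + 1 ≤ L) :
    ((({S : Finset (ZMod L) | CycGood p L S ∧ S.card = j} : Finset _).card : ℕ) : ℚ) =
      rotheA p j L := by
  cases j with
  | zero =>
    have : ({S : Finset (ZMod L) | CycGood p L S ∧ S.card = 0} : Finset _) = {∅} := by
      ext S
      simp only [Finset.mem_filter, Finset.mem_univ, true_and, Finset.mem_singleton,
        Finset.card_eq_zero]
      constructor
      · exact fun h => h.2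
      · rintro rfl; simp [CycGood]
    rw [this]; simp [rotheA]
  | succ j =>
    have hpL : p + 1 ≤ L := by rw [mul_add] at hL; omega
    have hd := Finset.sum_card_bipartiteAbove_eq_sum_card_bipartiteBelow
      (s := (Finset.univ : Finset (ZMod L)))
      (t := ({S : Finset (ZMod L) | CycGood p L S ∧ S.card = j + 1} : Finset _))
      (fun x S => x ∈ S)
    have h1 : ∀ x ∈ (Finset.univ : Finset (ZMod L)),
        (Finset.bipartiteAbove (fun x S => x ∈ S)
        ({S : Finset (ZMod L) | CycGood p L S ∧ S.card = j + 1} : Finset _) x).card =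
        (L - 1 - p * (j + 1)).choose j := by
      intro x _
      have := card_cyc_mem p L j hpL x
      rw [card_linSets] at this
      rw [Finset.bipartiteAbove, Finset.filter_filter]
      simp only [and_assoc]
      rw [this]
      cases j with
      | zero => simp
      | succ i =>
        congr 1
        have : p * (i + 1 + 1) = p * i + 2 * p := by ring
        have : p * (i + 1) = p * i + p := by ring
        omega
    have h2 : ∀ S ∈ ({S : Finset (ZMod L) | CycGood p L S ∧ S.card = j + 1} : Finset _),
        (Finset.bipartiteBelow (fun x S => x ∈ S) (Finset.univ : Finset (ZMod L)) S).card
          = j + 1 := by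
      intro S hS
      rw [← (Finset.mem_filter.1 hS).2.2]
      simp [Finset.bipartiteBelow]
    rw [Finset.sum_congr rfl h1, Finset.sum_congr rfl h2] at hd
    simp only [Finset.sum_const, Finset.card_univ, ZMod.card, smul_eq_mul] at hd
    have h3 := rotheA_nat p j L hL
    have hj : (j : ℚ) + 1 ≠ 0 := by positivity
    apply mul_left_cancel₀ hj
    rw [h3, mul_comm]
    exact_mod_cast hd.symm

open Polynomial in
lemma coeff_pow_rothe (p k L : ℕ) (P : ℚ[X]) (hP : ∀ j ≤ k, P.coeff j = rotheA p j L) (d : ℕ) :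
    ∀ j ≤ k, (P ^ d).coeff j = rotheA p j ((d * L : ℕ) : ℚ) := by
  induction d with
  | zero =>
    intro j hj
    cases j with
    | zero => simp [rotheA]
    | succ j => simp [rotheA, coeff_one]
  | succ d ih =>
    intro j hj
    rw [pow_succ, coeff_mul]
    have := rothe p j (d * L : ℕ) L
    rw [show (((d + 1) * L : ℕ) : ℚ) = ((d * L : ℕ) : ℤ) + L by push_cast; ring, ← this]
    apply Finset.sum_congr rfl
    intro ij hij
    have := Finset.HasAntidiagonal.mem_antidiagonal.1 hij
    rw [ih _ (by omega), hP _ (by omega)]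
    push_cast
    rfl

open Classical Polynomial in
lemma card_families (p k L d : ℕ) [NeZero L] (hL : p * k + 1 ≤ L) :
    ((({T : Fin d → Finset (ZMod L) | (∀ i, CycGood p L (T i)) ∧
      ∑ i, (T i).card = k} : Finset _).card : ℕ) : ℚ) = rotheA p k ((d * L : ℕ) : ℚ) := by
  let P : ℚ[X] := ∑ S ∈ ({S : Finset (ZMod L) | CycGood p L S} : Finset _), X ^ S.card
  have hP : ∀ j ≤ k, P.coeff j = rotheA p j L := by
    intro j hj
    rw [← card_cyc p L j (by have := Nat.mul_le_mul_left p hj; omega)]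
    simp only [P, finsetSum_coeff, coeff_X_pow]
    rw [Finset.sum_boole, Finset.filter_filter]
    simp only [eq_comm]
  rw [← coeff_pow_rothe p k L P hP d k le_rfl]
  have : P ^ d = ∏ _i : Fin d, P := by simp
  rw [this]
  simp only [P]
  rw [Finset.prod_univ_sum]
  simp only [finsetSum_coeff, Finset.prod_pow_eq_pow_sum, coeff_X_pow]
  rw [Finset.sum_boole]
  congr 2
  ext T
  simp [eq_comm]

open Classical in
theorem main_count (m p k n : ℕ) (hm : 1 ≤ m) (hp : 1 ≤ p) (hk : 1 ≤ k)
    (hn : m * p * k + 1 ≤ n) :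
    ((({S : Finset (ZMod n) | S.card = k ∧
        ∀ x ∈ S, ∀ y ∈ S, x ≠ y →
          ∀ a : ℕ, 1 ≤ a → a ≤ p → x - y ≠ ((a * m : ℕ) : ZMod n)}.ncard : ℕ) : ℚ)) =
      rotheA p k n := by
  have : NeZero n := ⟨by omega⟩
  obtain ⟨d, hd⟩ : ∃ d, d = Nat.gcd m n := ⟨_, rfl⟩
  have hd0 : 0 < d := hd ▸ Nat.gcd_pos_of_pos_left n hm
  obtain ⟨L, hL⟩ : d ∣ n := hd ▸ Nat.gcd_dvd_right m n
  obtain ⟨m', hm'⟩ : d ∣ m := hd ▸ Nat.gcd_dvd_left m n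
  have hcop : Nat.Coprime m' L := by
    have h := Nat.coprime_div_gcd_div_gcd (m := m) (n := n) (hd ▸ hd0)
    rw [← hd] at h
    rwa [hm', hL, Nat.mul_div_cancel_left _ hd0, Nat.mul_div_cancel_left _ hd0] at h
  have hm'0 : 0 < m' := by
    rcases Nat.eq_zero_or_pos m' with h | h
    · subst h; omega
    · exact h
  have hLk : p * k + 1 ≤ L := by
    by_contra hcon
    have h1 : L ≤ p * k := by omega
    have h2 : d * L ≤ m * (p * k) := by
      apply Nat.mul_le_mul _ h1
      rw [hm']; exact Nat.le_mul_of_pos_right d hm'0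
    rw [← mul_assoc] at h2
    omega
  have : NeZero L := ⟨by omega⟩
  let f : Fin d × ZMod L → ZMod n := fun iy => ((iy.1.val + m * iy.2.val : ℕ) : ZMod n)
  have hmodL : ∀ a b : ℕ, (a : ZMod L) = b → ((m * a : ℕ) : ZMod n) = ((m * b : ℕ) : ZMod n) := by
    intro a b h
    rw [ZMod.natCast_eq_natCast_iff] at h ⊢
    have h2 : m * a ≡ m * b [MOD (m * L)] := Nat.ModEq.mul_left' m h
    refine h2.of_dvd ?_
    rw [hm', hL]
    exact ⟨m', by ring⟩
  have hinj : Function.Injective f := by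
    rintro ⟨i, y⟩ ⟨i', y'⟩ h
    simp only [f] at h
    rw [ZMod.natCast_eq_natCast_iff] at h
    have h1 : i.val + m * y.val ≡ i'.val + m * y'.val [MOD d] := h.of_dvd ⟨L, hL⟩
    have h2 : i = i' := by
      rw [hm', mul_assoc, mul_assoc] at h1
      unfold Nat.ModEq at h1
      rw [Nat.add_mul_mod_self_left, Nat.add_mul_mod_self_left, Nat.mod_eq_of_lt i.2,
        Nat.mod_eq_of_lt i'.2] at h1
      exact Fin.ext h1
    subst h2
    have h3 : m * y.val ≡ m * y'.val [MOD n] := Nat.ModEq.add_left_cancel' _ h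
    rw [hm', hL, mul_assoc, mul_assoc] at h3
    have h4 := Nat.ModEq.mul_left_cancel' hd0.ne' h3
    have h5 := Nat.ModEq.cancel_left_of_coprime (by rw [Nat.gcd_comm]; exact hcop) h4
    have h6 := (ZMod.natCast_eq_natCast_iff _ _ _).2 h5
    rw [ZMod.natCast_zmod_val, ZMod.natCast_zmod_val] at h6
    rw [h6]
  have hbij : Function.Bijective f := by
    rw [Fintype.bijective_iff_injective_and_card]
    refine ⟨hinj, ?_⟩
    simp [ZMod.card, hL]
  let e : Fin d × ZMod L ≃ ZMod n := Equiv.ofBijective f hbij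
  have hstep : ∀ i y (a : ℕ), e (i, y + a) = e (i, y) + ((a * m : ℕ) : ZMod n) := by
    intro i y a
    have h := hmodL (y + a).val (y.val + a) (by simp)
    simp only [e, Equiv.ofBijective_apply, f]
    rw [Nat.cast_add, h]
    push_cast
    ring
  have hcard : ∀ S : Finset (ZMod n),
      ∑ i, (Finset.univ.filter (fun y => e (i, y) ∈ S)).card = S.card := by
    intro S
    simp only [Finset.card_filter]
    rw [← Fintype.sum_prod_type' (fun i y => if e (i, y) ∈ S then 1 else 0),
      Equiv.sum_comp e (fun z => if z ∈ S then 1 else 0)]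
    simp
  have hnL : (n : ℚ) = ((d * L : ℕ) : ℚ) := by rw [hL]
  rw [hnL, ← card_families p k L d hLk, Set.ncard_eq_toFinset_card']
  congr 1
  refine Finset.card_bij' (fun S _ => fun i => Finset.univ.filter (fun y => e (i, y) ∈ S))
    (fun T _ => Finset.univ.filter (fun z => (e.symm z).2 ∈ T (e.symm z).1)) ?_ ?_ ?_ ?_
  · intro S hS
    rw [Set.mem_toFinset] at hS
    obtain ⟨hc, hg⟩ := hS
    rw [Finset.mem_filter]
    refine ⟨Finset.mem_univ _, ?_, ?_⟩
    · intro i x hx y hy hxy a ha hap h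
      refine hg _ (Finset.mem_filter.1 hx).2 _ (Finset.mem_filter.1 hy).2 ?_ a ha hap ?_
      · intro h; exact hxy (Prod.ext_iff.1 (e.injective h)).2
      · rw [sub_eq_iff_eq_add'] at h ⊢
        rw [h, hstep]
    · rw [← hc]
      exact hcard S
  · intro T hT
    obtain ⟨-, hg, hc⟩ := Finset.mem_filter.1 hT
    rw [Set.mem_toFinset]
    refine ⟨?_, ?_⟩
    · rw [← hcard, ← hc]
      simp
    · intro x hx y hy hxy a ha hap h
      obtain ⟨⟨i, u⟩, rfl⟩ := e.surjective x
      obtain ⟨⟨i', v⟩, rfl⟩ := e.surjective y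
      rw [sub_eq_iff_eq_add', ← hstep] at h
      have h' := e.injective h
      simp only [Prod.mk.injEq] at h'
      obtain ⟨rfl, rfl⟩ := h'
      simp only [Finset.mem_filter, Equiv.symm_apply_apply, Finset.mem_univ, true_and] at hx hy
      exact hg _ _ hx _ hy (fun h => hxy (by rw [h])) a ha hap (by ring)
  · intro S hS
    ext z
    simp
  · intro T hT
    ext i y
    simp


/-- **Mansour–Sun theorem.**  Let `m, p, k ≥ 1` and `n ≥ mpk + 1`.  The number of
`k`-element subsets `S` of `ZMod n` such that for every ordered pair `(x, y)` of distinct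
elements of `S` the difference `x - y` (computed in `ZMod n`) does not belong to
`{m, 2m, …, pm}` (taken modulo `n`) equals `(n / (n - pk)) * C(n - pk, k)`; in particular
it is independent of `m`. -/
theorem statement0 (m p k n : ℕ) (hm : 1 ≤ m) (hp : 1 ≤ p) (hk : 1 ≤ k)
    (hn : m * p * k + 1 ≤ n) :
    (({S : Finset (ZMod n) | S.card = k ∧
        ∀ x ∈ S, ∀ y ∈ S, x ≠ y →
          ∀ a : ℕ, 1 ≤ a → a ≤ p → x - y ≠ ((a * m : ℕ) : ZMod n)}.ncard : ℚ)) =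
      (n : ℚ) / ((n - p * k : ℕ) : ℚ) * ((n - p * k).choose k : ℚ) := by
  rw [main_count m p k n hm hp hk hn]
  apply rotheA_final p k n hk
  have : p * k ≤ m * p * k := by
    rw [mul_assoc]; exact Nat.le_mul_of_pos_left _ hm
  omega
end

section
/- Let k ≥ 1 and n ≥ 2k + 1. The number of k-element subsets S of the cyclic group Z_n such that no two distinct elements of S are uni-separated, i.e., for all distinct x, y ∈ S one has x − y ≢ 2 (mod n), is equal to (n/(n − k)) · C(n − k, k). -/
open Finset in
/-- number of `k`-subsets of `range n` containing no `x` together with `f x` -/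
def cnt (n k : ℕ) (f : ℕ → ℕ) : ℕ :=
  (((range n).powersetCard k).filter (fun S => ∀ x ∈ S, f x ∉ S)).card

open Finset in
lemma cnt_le (n k : ℕ) (f f' g : ℕ → ℕ) (hg : ∀ x < n, g x < n)
    (hinj : ∀ x < n, ∀ y < n, g x = g y → x = y) (hf : ∀ x < n, f x < n)
    (hc : ∀ x < n, g (f x) = f' (g x)) : cnt n k f ≤ cnt n k f' := by
  unfold cnt
  have hin : ∀ S ∈ ((range n).powersetCard k).filter (fun S => ∀ x ∈ S, f x ∉ S),
      (∀ x ∈ S, x < n) ∧ S.card = k ∧ ∀ x ∈ S, f x ∉ S := by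
    intro S hS
    simp only [mem_filter, mem_powersetCard] at hS
    exact ⟨fun x hx => mem_range.1 (hS.1.1 hx), hS.1.2, hS.2⟩
  apply card_le_card_of_injOn (fun S => S.image g)
  · intro S hS
    obtain ⟨h1, h2, h3⟩ := hin S hS
    simp only [coe_filter, Set.mem_ofPred_eq, mem_powersetCard]
    refine ⟨⟨?_, ?_⟩, ?_⟩
    · intro y hy
      obtain ⟨x, hx, rfl⟩ := mem_image.1 hy
      exact mem_range.2 (hg x (h1 x hx))
    · rw [card_image_of_injOn, h2]
      intro x hx y hy h
      exact hinj x (h1 x hx) y (h1 y hy) h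
    · intro y hy hy'
      obtain ⟨x, hx, rfl⟩ := mem_image.1 hy
      rw [← hc x (h1 x hx)] at hy'
      obtain ⟨z, hz, hzx⟩ := mem_image.1 hy'
      have := hinj z (h1 z hz) (f x) (hf x (h1 x hx)) hzx
      exact h3 x hx (this ▸ hz)
  · have key : ∀ S T : Finset ℕ, (∀ x ∈ S, x < n) → (∀ x ∈ T, x < n) →
        S.image g = T.image g → S ⊆ T := by
      intro S T hS hT h x hx
      have : g x ∈ T.image g := h ▸ mem_image_of_mem g hx
      obtain ⟨z, hz, hzx⟩ := mem_image.1 this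
      exact hinj z (hT z hz) x (hS x hx) hzx ▸ hz
    intro S hS T hT h
    exact Subset.antisymm (key S T (hin S hS).1 (hin T hT).1 h)
      (key T S (hin T hT).1 (hin S hS).1 h.symm)

def st1 (n x : ℕ) : ℕ := if x + 1 < n then x + 1 else 0
def st2 (n x : ℕ) : ℕ := if x + 2 < n then x + 2 else x + 2 - n
def stT (n x : ℕ) : ℕ := if x + 2 < n then x + 2 else n - 1 - x

lemma cnt_odd (n k m : ℕ) (hm : n = 2 * m + 1) (h : 1 ≤ m) :
    cnt n k (st2 n) = cnt n k (st1 n) := by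
  apply le_antisymm
  · apply cnt_le n k _ _ (fun x => if x % 2 = 0 then x / 2 else (x + n) / 2) <;>
      (try simp only [st1, st2]) <;> intros <;> grind
  · apply cnt_le n k _ _ (fun x => if 2 * x < n then 2 * x else 2 * x - n) <;>
      (try simp only [st1, st2]) <;> intros <;> grind

lemma cnt_T (n k m : ℕ) (hm : n = 2 * m) (h : 2 ≤ m) :
    cnt n k (stT n) = cnt n k (st1 n) := by
  apply le_antisymm
  · apply cnt_le n k _ _ (fun x => if x % 2 = 0 then x / 2 else x / 2 + m) <;>
      (try simp only [st1, stT]) <;> intros <;> grind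
  · apply cnt_le n k _ _ (fun x => if x < m then 2 * x else 2 * (x - m) + 1) <;>
      (try simp only [st1, stT]) <;> intros <;> grind

/-- swap the two entries of each column `{2j, 2j+1}`, `j < i` -/
def sw (i x : ℕ) : ℕ := if x < 2 * i then (if x % 2 = 0 then x + 1 else x - 1) else x

lemma sw_sw (i x : ℕ) : sw i (sw i x) = x := by
  unfold sw; split_ifs <;> omega

lemma sw_div (i x : ℕ) : sw i x / 2 = x / 2 := by
  unfold sw; split_ifs <;> omega

lemma sw_inj (i : ℕ) : Function.Injective (sw i) :=
  Function.LeftInverse.injective (sw_sw i)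

open Finset in
lemma mem_sw (i x : ℕ) (S : Finset ℕ) : x ∈ S.image (sw i) ↔ sw i x ∈ S := by
  constructor
  · intro h
    obtain ⟨z, hz, rfl⟩ := mem_image.1 h
    rwa [sw_sw]
  · intro h
    exact mem_image.2 ⟨_, h, sw_sw i x⟩

lemma exists_empty_col (S : Finset ℕ) (m : ℕ) (h : S.card < m) :
    ∃ i, i < m ∧ ∀ x ∈ S, x / 2 ≠ i := by
  by_contra! hc
  have : Finset.range m ⊆ S.image (fun x => x / 2) := by
    intro i hi
    obtain ⟨x, hx, e⟩ := hc i (Finset.mem_range.1 hi)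
    exact Finset.mem_image.2 ⟨x, hx, e⟩
  have h1 := Finset.card_le_card this
  have h2 := Finset.card_image_le (s := S) (f := fun x => x / 2)
  simp only [Finset.card_range] at h1
  omega

open Classical in
/-- index of the first empty column -/
noncomputable def fc (S : Finset ℕ) : ℕ := sInf {i | ∀ x ∈ S, x / 2 ≠ i}

lemma col_sw (i : ℕ) (S : Finset ℕ) :
    {j | ∀ x ∈ S.image (sw i), x / 2 ≠ j} = {j | ∀ x ∈ S, x / 2 ≠ j} := by
  ext j
  simp [sw_div]

lemma fc_sw (i : ℕ) (S : Finset ℕ) : fc (S.image (sw i)) = fc S := by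
  unfold fc; rw [col_sw]

lemma fc_spec (S : Finset ℕ) (m : ℕ) (h : S.card < m) :
    fc S < m ∧ ∀ x ∈ S, x / 2 ≠ fc S := by
  obtain ⟨i, hi, hS⟩ := exists_empty_col S m h
  constructor
  · exact lt_of_le_of_lt (Nat.sInf_le hS) hi
  · exact Nat.sInf_mem (s := {i | ∀ x ∈ S, x / 2 ≠ i}) ⟨i, hS⟩

open Finset in
lemma cnt_swap_le (n k m : ℕ) (hm : n = 2 * m) (hk : k < m) (f f' : ℕ → ℕ)
    (hff : ∀ i < m, ∀ x < n, x / 2 ≠ i →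
      sw i (f' (sw i x)) = f x ∨ sw i (f' (sw i x)) / 2 = i) :
    cnt n k f ≤ cnt n k f' := by
  unfold cnt
  apply card_le_card_of_injOn (fun S => S.image (sw (fc S)))
  · intro S hS
    simp only [coe_filter, Set.mem_ofPred_eq, mem_powersetCard] at hS ⊢
    obtain ⟨⟨h1, h2⟩, h3⟩ := hS
    obtain ⟨hi, hcol⟩ := fc_spec S m (by omega)
    refine ⟨⟨?_, ?_⟩, ?_⟩
    · intro y hy
      rw [mem_sw] at hy
      have a := mem_range.1 (h1 hy)
      have b := sw_div (fc S) y
      exact mem_range.2 (by omega)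
    · rw [card_image_of_injective _ (sw_inj _), h2]
    · intro y hy hy'
      obtain ⟨x, hx, rfl⟩ := mem_image.1 hy
      rw [mem_sw] at hy'
      rcases hff (fc S) hi x (mem_range.1 (h1 hx)) (hcol x hx) with h | h
      · rw [h] at hy'; exact h3 x hx hy'
      · exact hcol _ hy' h
  · intro S _ T _ h
    simp only at h
    have h' := congrArg fc h
    rw [fc_sw, fc_sw] at h'
    rw [h'] at h
    exact image_injective (sw_inj _) h

lemma cnt_even (n k m : ℕ) (hm : n = 2 * m) (hk : k < m) (h : 2 ≤ m) :
    cnt n k (st2 n) = cnt n k (stT n) := by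
  apply le_antisymm
  · apply cnt_swap_le n k m hm hk
    intro i hi x hx hxi
    simp only [sw, st2, stT]
    split_ifs <;> omega
  · apply cnt_swap_le n k m hm hk
    intro i hi x hx hxi
    simp only [sw, st2, stT]
    split_ifs <;> omega

open Finset in
lemma split_count (b k : ℕ) (U : Finset ℕ) (hb : b ∉ U) (p : Finset ℕ → Prop)
    [DecidablePred p] :
    (((insert b U).powersetCard (k + 1)).filter p).card =
      ((U.powersetCard (k + 1)).filter p).card +
      ((U.powersetCard k).filter (fun T => p (insert b T))).card := by
  rw [powersetCard_succ_insert hb, filter_union, card_union_of_disjoint, filter_image,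
    card_image_of_injOn]
  · intro S hS T hT h
    simp only [coe_filter, Set.mem_ofPred_eq, mem_powersetCard] at hS hT
    have hS' : b ∉ S := fun h => hb (hS.1.1 h)
    have hT' : b ∉ T := fun h => hb (hT.1.1 h)
    rw [← erase_insert hS', ← erase_insert hT']
    rw [h]
  · rw [disjoint_left]
    intro S hS hS'
    simp only [mem_filter, mem_image, mem_powersetCard] at hS hS'
    obtain ⟨⟨T, _, rfl⟩, _⟩ := hS'
    exact hb (hS.1.1 (mem_insert_self _ _))

open Finset in
def pth (a m k : ℕ) : ℕ :=
  (((Ico a (a + m)).powersetCard k).filter (fun S => ∀ x ∈ S, x + 1 ∉ S)).card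

open Finset in
lemma pth_rec (a m k : ℕ) : pth a (m + 2) (k + 1) = pth a (m + 1) (k + 1) + pth a m k := by
  unfold pth
  have e : Ico a (a + (m + 2)) = insert (a + m + 1) (Ico a (a + (m + 1))) := by
    ext x; simp only [mem_Ico, mem_insert]; omega
  rw [e, split_count _ _ _ (by simp; omega)]
  congr 2
  ext S
  simp only [mem_filter, mem_powersetCard, subset_iff, mem_Ico, mem_insert]
  constructor
  · rintro ⟨⟨h1, h2⟩, h3⟩
    refine ⟨⟨?_, h2⟩, ?_⟩
    · intro x hx
      have a1 := h1 hx
      have a2 := h3 x (Or.inr hx)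
      push Not at a2
      omega
    · intro x hx hx'
      exact h3 x (Or.inr hx) (Or.inr hx')
  · rintro ⟨⟨h1, h2⟩, h3⟩
    refine ⟨⟨?_, h2⟩, ?_⟩
    · intro x hx
      have a1 := h1 hx
      omega
    · rintro x (rfl | hx) (h | h)
      · omega
      · have := h1 h; omega
      · have := h1 hx; omega
      · exact h3 x hx h

open Finset in
lemma pth_zero (a m : ℕ) : pth a m 0 = 1 := by
  unfold pth
  simp [filter_singleton]

open Finset in
lemma pth_small (a m k : ℕ) (h : m < k) : pth a m k = 0 := by
  unfold pth
  rw [powersetCard_eq_empty.2 (by simpa using h)]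
  simp

open Finset in
lemma pth_one_one (a : ℕ) : pth a 1 1 = 1 := by
  unfold pth
  have : Ico a (a + 1) = {a} := by ext; simp
  rw [this, powersetCard_one]
  simp [filter_singleton]

lemma pth_eq (a m : ℕ) : ∀ k, pth a m k = (m + 1 - k).choose k := by
  induction m using Nat.strong_induction_on with
  | _ m ih =>
    intro k
    rcases k with _ | k
    · simp [pth_zero]
    rcases m with _ | _ | m
    · rw [pth_small _ _ _ (by omega)]
      symm; apply Nat.choose_eq_zero_of_lt; omega
    · rcases k with _ | k
      · simp [pth_one_one]
      · rw [pth_small _ _ _ (by omega)]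
        symm; apply Nat.choose_eq_zero_of_lt; omega
    · rw [pth_rec, ih (m + 1) (by omega), ih m (by omega)]
      by_cases h : k ≤ m + 1
      · have e1 : m + 1 + 1 + 1 - (k + 1) = (m + 1 - k) + 1 := by omega
        have e2 : m + 1 + 1 - (k + 1) = m + 1 - k := by omega
        rw [e1, e2, Nat.choose_succ_succ']
        omega
      · rw [Nat.choose_eq_zero_of_lt, Nat.choose_eq_zero_of_lt, Nat.choose_eq_zero_of_lt] <;> omega

open Finset in
lemma cyc_rec (n k : ℕ) : cnt (n + 3) (k + 1) (st1 (n + 3)) = pth 0 (n + 2) (k + 1) + pth 1 n k := by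
  unfold pth cnt
  have e : range (n + 3) = insert (n + 2) (Ico 0 (0 + (n + 2))) := by
    ext x; simp only [mem_Ico, mem_insert, mem_range]; omega
  rw [e, split_count _ _ _ (by simp)]
  congr 2
  · apply filter_congr
    intro S hS
    simp only [mem_powersetCard, subset_iff, mem_Ico] at hS
    have : ∀ x ∈ S, st1 (n + 3) x = x + 1 := by
      intro x hx
      have := hS.1 hx
      unfold st1; split_ifs <;> omega
    exact forall₂_congr fun x hx => by rw [this x hx]
  · ext S
    simp only [mem_filter, mem_powersetCard, subset_iff, mem_Ico, mem_insert]
    constructor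
    · rintro ⟨⟨h1, h2⟩, h3⟩
      have h0 : 0 ∉ S := by
        have := h3 (n + 2) (Or.inl rfl)
        simp [st1] at this
        exact this
      have hs : ∀ x ∈ S, x + 1 ≠ n + 2 ∧ x + 1 ∉ S := by
        intro x hx
        have b := h1 hx
        have a2 := h3 x (Or.inr hx)
        have : st1 (n + 3) x = x + 1 := by unfold st1; split_ifs <;> omega
        rw [this] at a2
        push Not at a2
        exact a2
      refine ⟨⟨?_, h2⟩, fun x hx => (hs x hx).2⟩
      intro x hx
      have a1 := h1 hx
      have a2 := (hs x hx).1
      have a3 : x ≠ 0 := fun h => h0 (h ▸ hx)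
      omega
    · rintro ⟨⟨h1, h2⟩, h3⟩
      refine ⟨⟨?_, h2⟩, ?_⟩
      · intro x hx
        have a1 := h1 hx
        omega
      · rintro x (rfl | hx) (h | h)
        · simp [st1] at h
        · have := h1 h; simp [st1] at this
        · have := h1 hx
          unfold st1 at h; split_ifs at h <;> omega
        · have := h1 hx
          have e : st1 (n + 3) x = x + 1 := by unfold st1; split_ifs <;> omega
          rw [e] at h
          exact h3 x hx h

open Finset in
lemma ncard_eq_cnt (k n : ℕ) (hn : 3 ≤ n) :
    {S : Finset (ZMod n) | S.card = k ∧
        ∀ x ∈ S, ∀ y ∈ S, x ≠ y → x - y ≠ 2}.ncard = cnt n k (st2 n) := by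
  haveI : NeZero n := ⟨by omega⟩
  have hv : Function.Injective (ZMod.val : ZMod n → ℕ) := ZMod.val_injective n
  have hst : ∀ x : ZMod n, (x + 2).val = st2 n x.val := by
    intro x
    have hx := ZMod.val_lt x
    have h2 : (2 : ZMod n).val = 2 := by
      have := ZMod.val_natCast_of_lt (n := n) (a := 2) (by omega)
      simpa using this
    rw [ZMod.val_add, h2]
    unfold st2
    split_ifs with h
    · exact Nat.mod_eq_of_lt h
    · rw [Nat.mod_eq_sub_mod (by omega), Nat.mod_eq_of_lt (by omega)]
  have hne : ∀ x : ZMod n, x + 2 ≠ x := by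
    intro x h
    have h1 := hst x
    have hx := ZMod.val_lt x
    rw [h] at h1
    unfold st2 at h1
    split_ifs at h1 <;> omega
  have hiff : ∀ S : Finset (ZMod n), (∀ x ∈ S, ∀ y ∈ S, x ≠ y → x - y ≠ 2) ↔
      ∀ x ∈ S.image ZMod.val, st2 n x ∉ S.image ZMod.val := by
    intro S
    constructor
    · intro h x hx hx'
      obtain ⟨z, hz, rfl⟩ := mem_image.1 hx
      rw [← hst] at hx'
      obtain ⟨w, hw, hwz⟩ := mem_image.1 hx'
      have := hv hwz
      subst this
      exact h _ hw _ hz (hne z) (by ring)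
    · intro h x hx y hy _ hxy
      have : x = y + 2 := by rw [← hxy]; ring
      subst this
      apply h y.val (mem_image_of_mem _ hy)
      rw [← hst]
      exact mem_image_of_mem _ hx
  unfold cnt
  rw [← Set.ncard_coe_finset, ← Set.ncard_image_of_injective _ (image_injective hv)]
  congr 1
  ext T
  simp only [Set.mem_image, Set.mem_ofPred_eq, coe_filter, mem_powersetCard]
  constructor
  · rintro ⟨S, ⟨h1, h2⟩, rfl⟩
    refine ⟨⟨?_, ?_⟩, (hiff S).1 h2⟩
    · intro y hy
      obtain ⟨x, _, rfl⟩ := mem_image.1 hy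
      exact mem_range.2 (ZMod.val_lt x)
    · rw [card_image_of_injective _ hv, h1]
  · rintro ⟨⟨h1, h2⟩, h3⟩
    have e : (T.image (Nat.cast : ℕ → ZMod n)).image ZMod.val = T := by
      rw [image_image]
      conv_rhs => rw [← image_id (s := T)]
      apply image_congr
      intro x hx
      exact ZMod.val_natCast_of_lt (mem_range.1 (h1 hx))
    refine ⟨T.image (Nat.cast : ℕ → ZMod n), ⟨?_, ?_⟩, e⟩
    · rw [← card_image_of_injective _ hv, e, h2]
    · rw [hiff, e]; exact h3

/-- **Konvalina's theorem.**  Let `k ≥ 1` and `n ≥ 2k + 1`.  The number of `k`-element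
subsets `S` of `ZMod n` such that no two distinct elements of `S` are uni-separated
(i.e. `x - y ≠ 2` in `ZMod n` for all distinct `x, y ∈ S`) equals the Kaplansky number
`(n / (n - k)) * C(n - k, k)`. -/
theorem statement3 (k n : ℕ) (hk : 1 ≤ k) (hn : 2 * k + 1 ≤ n) :
    (({S : Finset (ZMod n) | S.card = k ∧
        ∀ x ∈ S, ∀ y ∈ S, x ≠ y → x - y ≠ 2}.ncard : ℚ)) =
      (n : ℚ) / ((n - k : ℕ) : ℚ) * ((n - k).choose k : ℚ) := by
  rw [ncard_eq_cnt k n (by omega)]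
  have h1 : cnt n k (st2 n) = cnt n k (st1 n) := by
    rcases Nat.even_or_odd' n with ⟨m, hm | hm⟩
    · rw [cnt_even n k m hm (by omega) (by omega), cnt_T n k m hm (by omega)]
    · exact cnt_odd n k m hm (by omega)
  rw [h1]
  obtain ⟨n, rfl⟩ : ∃ n', n = n' + 3 := ⟨n - 3, by omega⟩
  obtain ⟨k, rfl⟩ : ∃ k', k = k' + 1 := ⟨k - 1, by omega⟩
  rw [cyc_rec, pth_eq, pth_eq]
  obtain ⟨a, ha⟩ : ∃ a, n + 3 - (k + 1) = a + 1 := ⟨n + 3 - (k + 1) - 1, by omega⟩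
  have e1 : n + 2 + 1 - (k + 1) = a + 1 := by omega
  have e2 : n + 1 - k = a := by omega
  rw [e1, e2]
  have hc := Nat.add_one_mul_choose_eq a k
  have hc' : ((a : ℚ) + 1) * (a.choose k : ℚ) = ((a + 1).choose (k + 1) : ℚ) * ((k : ℚ) + 1) := by
    exact_mod_cast hc
  have hn3 : ((n + 3 : ℕ) : ℚ) = (a : ℚ) + 1 + (k + 1) := by
    have : n + 3 = a + 1 + (k + 1) := by omega
    rw [this]; push_cast; ring
  have hpos : ((a : ℚ) + 1) ≠ 0 := by positivity
  rw [hn3]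
  push_cast
  rw [div_mul_eq_mul_div, eq_div_iff hpos]
  linear_combination hc'
end

section
/- Let m ≥ 1, let r ≥ 2, let 1 < i_2 < i_3 < ⋯ < i_r be integers, let k_1, k_2, …, k_r ≥ 1, and let n = k_1 + k_2·i_2 + ⋯ + k_r·i_r. Assume the condition ⌈k_1/(k_2 + ⋯ + k_r)⌉ ≥ (m − 1)(i_r − 1). Then the number of m-AP-partitions of Z_n of type 1^{k_1} i_2^{k_2} ⋯ i_r^{k_r} is independent of m and equals the cyclic multinomial coefficient (n/(k_1 + ⋯ + k_r)) · (k_1 + ⋯ + k_r)! / (k_1! k_2! ⋯ k_r!). -/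
/-- The underlying set of the `m`-AP-block of `ZMod n` with head `b.1` and length `b.2`,
namely `{b.1, b.1 + m, b.1 + 2m, …, b.1 + (b.2 - 1)m}` modulo `n`. -/
def blockSet (n m : ℕ) (b : ZMod n × ℕ) : Finset (ZMod n) :=
  (Finset.range b.2).image fun j => b.1 + ((j * m : ℕ) : ZMod n)

/-- `π` is an `m`-AP-partition of `ZMod n`: a set of `m`-AP-blocks (each recorded by its
head and its length, which must be positive) whose underlying sets form a partition of
`ZMod n`. -/
def IsAPPartition (n m : ℕ) (π : Finset (ZMod n × ℕ)) : Prop :=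
  (∀ b ∈ π, 1 ≤ b.2) ∧
  (∀ b₁ ∈ π, ∀ b₂ ∈ π, b₁ ≠ b₂ → Disjoint (blockSet n m b₁) (blockSet n m b₂)) ∧
  (∀ z : ZMod n, ∃ b ∈ π, z ∈ blockSet n m b)

/-- `π` has type `i₁ ^ k₁ i₂ ^ k₂ ⋯ i_r ^ k_r`: every block has length `i j` for some
`1 ≤ j ≤ r`, and for each `1 ≤ j ≤ r` there are exactly `k j` blocks of length `i j`. -/
def HasType (n : ℕ) (π : Finset (ZMod n × ℕ)) (r : ℕ) (i k : ℕ → ℕ) : Prop :=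
  (∀ b ∈ π, ∃ j, 1 ≤ j ∧ j ≤ r ∧ b.2 = i j) ∧
  (∀ j, 1 ≤ j → j ≤ r → (π.filter fun b => b.2 = i j).card = k j)


/-- Combinatorial system: blocks with heads `g t` and lengths `w t` on `ℕ`. -/
structure Sys (m C : ℕ) (g w : ℕ → ℕ) : Prop where
  mono : StrictMono g
  disj : ∀ s t j, s < t → j < w s → g t ≠ g s + j * m
  cover : ∀ c, C ≤ c → ∃ s j, j < w s ∧ c = g s + j * m

def Clean (m : ℕ) (g w : ℕ → ℕ) (T : ℕ) : Prop :=
  ∀ s, s < T → ∀ j, j < w s → g s + j * m < g T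

theorem clean_of_run {m C I t : ℕ} {g w : ℕ → ℕ} (hm : 1 ≤ m) (S : Sys m C g w)
    (hI : ∀ s, w s ≤ I)
    (hrun : ∀ u, 1 ≤ u → u ≤ (m - 1) * (I - 1) → w (t + u) = 1) :
    Clean m g w (t + (m - 1) * (I - 1) + 1) := by
  set L := (m - 1) * (I - 1) with hL
  intro s hs j hj
  by_contra hcon
  push Not at hcon
  have hne := S.disj s (t + L + 1) j hs hj
  have hlt : g (t + L + 1) < g s + j * m := lt_of_le_of_ne hcon hne
  have hst : s ≤ t := by
    by_contra h
    push Not at h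
    have h1 := hrun (s - t) (by omega) (by omega)
    rw [show t + (s - t) = s by omega] at h1
    have hj0 : j = 0 := by omega
    subst hj0
    have := S.mono hs
    omega
  set e := g s + j * m with he
  have hjI : j ≤ I - 1 := by have := hI s; omega
  have hgs : g s ≤ g t := S.mono.monotone hst
  have hjm : j * m ≤ (I - 1) * m := Nat.mul_le_mul_right _ hjI
  have key : ∀ u, u < L + 1 → g t < g (t + 1 + u) ∧ g (t + 1 + u) < e := by
    intro u hu
    refine ⟨S.mono (by omega), lt_of_le_of_lt (S.mono.monotone (by omega)) hlt⟩
  have hcard : (Finset.range (L + 1)).card ≤ (Finset.range (I - 1) ×ˢ Finset.Ico 1 m).card := by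
    apply Finset.card_le_card_of_injOn
      (fun u => ((e - g (t + 1 + u)) / m, (e - g (t + 1 + u)) % m))
    · intro u hu
      simp only [Finset.coe_range, Set.mem_Iio] at hu
      obtain ⟨k1, k2⟩ := key u hu
      simp only [Finset.coe_product, Set.mem_prod, Finset.coe_range, Set.mem_Iio, Finset.coe_Ico,
        Set.mem_Ico]
      refine ⟨?_, ?_, Nat.mod_lt _ hm⟩
      · rw [Nat.div_lt_iff_lt_mul hm]
        omega
      · by_contra h0
        have h0 : (e - g (t + 1 + u)) % m = 0 := by omega
        obtain ⟨a, ha⟩ := Nat.dvd_of_mod_eq_zero h0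
        have haj : a ≤ j := by
          by_contra hh
          push Not at hh
          have : j * m < a * m := Nat.mul_lt_mul_of_pos_right hh hm
          rw [mul_comm m a] at ha
          omega
        refine S.disj s (t + 1 + u) (j - a) (by omega) (by omega) ?_
        rw [Nat.sub_mul]
        have : a * m ≤ j * m := Nat.mul_le_mul_right _ haj
        rw [mul_comm m a] at ha
        omega
    · intro u hu v hv huv
      simp only [Finset.coe_range, Set.mem_Iio] at hu hv
      obtain ⟨k1, k2⟩ := key u hu
      obtain ⟨k3, k4⟩ := key v hv
      simp only [Prod.mk.injEq] at huv
      have h1 := Nat.div_add_mod (e - g (t + 1 + u)) m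
      rw [huv.1, huv.2, Nat.div_add_mod] at h1
      have : g (t + 1 + u) = g (t + 1 + v) := by omega
      have := S.mono.injective this
      omega
  rw [Finset.card_range, Finset.card_product, Finset.card_range, Nat.card_Ico, mul_comm] at hcard
  omega

theorem sys_le {m C C' T T' : ℕ} {g w g' w' : ℕ → ℕ} (S : Sys m C g w) (S' : Sys m C' g' w')
    (cl : Clean m g' w' T') (hC : C' ≤ g' T')
    (hw : ∀ u, w (T + u) = w' (T' + u)) (u : ℕ)
    (ih : ∀ v, v < u → g (T + v) + g' T' = g' (T' + v) + g T) :
    g' (T' + u) + g T ≤ g (T + u) + g' T' := by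
  by_contra hcon
  push Not at hcon
  have h0 : g T ≤ g (T + u) := S.mono.monotone (by omega)
  obtain ⟨s, j, hj, hc⟩ := S'.cover (g' T' + (g (T + u) - g T)) (by omega)
  have hs1 : s < T' + u := by
    by_contra h
    push Not at h
    have := S'.mono.monotone h
    have : 0 ≤ j * m := Nat.zero_le _
    omega
  have hs2 : T' ≤ s := by
    by_contra h
    push Not at h
    have := cl s h j hj
    omega
  obtain ⟨v, rfl⟩ := Nat.exists_eq_add_of_le hs2
  have hv : v < u := by omega
  have := ih v hv
  refine S.disj (T + v) (T + u) j (by omega) (by rw [hw]; exact hj) ?_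
  omega

theorem sys_unique {m C C' T T' : ℕ} {g w g' w' : ℕ → ℕ} (S : Sys m C g w) (S' : Sys m C' g' w')
    (cl : Clean m g w T) (cl' : Clean m g' w' T') (hC : C ≤ g T) (hC' : C' ≤ g' T')
    (hw : ∀ u, w (T + u) = w' (T' + u)) (u : ℕ) :
    g (T + u) + g' T' = g' (T' + u) + g T := by
  induction u using Nat.strong_induction_on with
  | _ u ih =>
    apply le_antisymm
    · exact sys_le S' S cl hC (fun u => (hw u).symm) u (fun v hv => (ih v hv).symm)
    · exact sys_le S S' cl' hC' hw u ih

noncomputable def occ (m : ℕ) (w : ℕ → ℕ) : ℕ → Finset ℕ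
  | 0 => ∅
  | t + 1 => occ m w t ∪ (Finset.range (w t)).image
      (fun j => sInf {c | c ∉ occ m w t} + j * m)

theorem exists_sys (m : ℕ) (w : ℕ → ℕ) (hw : ∀ t, 1 ≤ w t) : ∃ h, Sys m 0 h w := by
  set h : ℕ → ℕ := fun t => sInf {c | c ∉ occ m w t} with hh
  have hsucc : ∀ t c, c ∈ occ m w (t + 1) ↔ c ∈ occ m w t ∨ ∃ j, j < w t ∧ c = h t + j * m := by
    intro t c
    simp only [occ, Finset.mem_union, Finset.mem_image, Finset.mem_range, hh]
    constructor
    · rintro (h | ⟨j, h1, h2⟩)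
      · exact Or.inl h
      · exact Or.inr ⟨j, h1, h2.symm⟩
    · rintro (h | ⟨j, h1, h2⟩)
      · exact Or.inl h
      · exact Or.inr ⟨j, h1, h2.symm⟩
  have hocc : ∀ t c, c ∈ occ m w t ↔ ∃ s, s < t ∧ ∃ j, j < w s ∧ c = h s + j * m := by
    intro t
    induction t with
    | zero => intro c; simp [occ]
    | succ t ih =>
      intro c
      rw [hsucc, ih]
      constructor
      · rintro (⟨s, h1, h2⟩ | h2)
        · exact ⟨s, by omega, h2⟩
        · exact ⟨t, by omega, h2⟩
      · rintro ⟨s, h1, h2⟩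
        rcases Nat.lt_succ_iff_lt_or_eq.mp h1 with h3 | rfl
        · exact Or.inl ⟨s, h3, h2⟩
        · exact Or.inr h2
  have hmem : ∀ t, h t ∉ occ m w t := by
    intro t
    have : {c | c ∉ occ m w t}.Nonempty := by
      obtain ⟨c, hc⟩ := Infinite.exists_notMem_finset (occ m w t)
      exact ⟨c, hc⟩
    exact Nat.sInf_mem this
  have hlt : ∀ t c, c < h t → c ∈ occ m w t := by
    intro t c hc
    have := Nat.notMem_of_lt_sInf hc
    simpa using this
  have hmono : StrictMono h := by
    apply strictMono_nat_of_lt_succ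
    intro t
    by_contra hcon
    push Not at hcon
    rcases lt_or_eq_of_le hcon with h1 | h1
    · exact hmem (t + 1) ((hsucc _ _).2 (Or.inl (hlt _ _ h1)))
    · exact hmem (t + 1) ((hsucc _ _).2 (Or.inr ⟨0, hw t, by omega⟩))
  refine ⟨h, hmono, ?_, ?_⟩
  · intro s t j hst hj he
    exact hmem t ((hocc _ _).2 ⟨s, hst, j, hj, he⟩)
  · intro c _
    have h1 : c < h (c + 1) := lt_of_lt_of_le (Nat.lt_succ_self c) (hmono.le_apply)
    obtain ⟨s, _, j, h2⟩ := (hocc _ _).1 (hlt _ _ h1)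
    exact ⟨s, j, h2⟩

theorem blocks_inj {m C : ℕ} {g w : ℕ → ℕ} (S : Sys m C g w) {s t j j' : ℕ}
    (hj : j < w s) (hj' : j' < w t) (h : g s + j * m = g t + j' * m) : s = t := by
  have aux : ∀ s t j j' : ℕ, s < t → j < w s → j' < w t → g s + j * m ≠ g t + j' * m := by
    intro s t j j' hst hj hj' h
    have h1 := S.mono hst
    by_cases hjj : j' ≤ j
    · refine S.disj s t (j - j') hst (by omega) ?_
      rw [Nat.sub_mul]
      have := Nat.mul_le_mul_right m hjj
      omega
    · push Not at hjj
      have := Nat.mul_le_mul_right m hjj.le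
      omega
  rcases lt_trichotomy s t with h1 | h1 | h1
  · exact absurd h (aux _ _ _ _ h1 hj hj')
  · exact h1
  · exact absurd h.symm (aux _ _ _ _ h1 hj' hj)

theorem clean_sum {m T N : ℕ} {h w : ℕ → ℕ} (hm : 1 ≤ m) (S : Sys m 0 h w)
    (c1 : Clean m h w T) (c2 : Clean m h w (T + N)) :
    h (T + N) = h T + ∑ u ∈ Finset.range N, w (T + u) := by
  have hU : Finset.Ico (h T) (h (T + N)) = (Finset.range N).biUnion
      (fun u => (Finset.range (w (T + u))).image (fun j => h (T + u) + j * m)) := by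
    ext c
    simp only [Finset.mem_Ico, Finset.mem_biUnion, Finset.mem_range, Finset.mem_image]
    constructor
    · rintro ⟨h1, h2⟩
      obtain ⟨s, j, hj, hc⟩ := S.cover c (Nat.zero_le _)
      have hs1 : s < T + N := by
        by_contra hcon
        push Not at hcon
        have := S.mono.monotone hcon
        have : 0 ≤ j * m := Nat.zero_le _
        omega
      have hs2 : T ≤ s := by
        by_contra hcon
        push Not at hcon
        have := c1 s hcon j hj
        omega
      obtain ⟨v, rfl⟩ := Nat.exists_eq_add_of_le hs2
      exact ⟨v, by omega, j, hj, hc.symm⟩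
    · rintro ⟨u, hu, j, hj, rfl⟩
      refine ⟨?_, c2 _ (by omega) _ hj⟩
      have := S.mono.monotone (show T ≤ T + u by omega)
      omega
  have hcard := congrArg Finset.card hU
  rw [Nat.card_Ico, Finset.card_biUnion] at hcard
  · have : ∀ u ∈ Finset.range N, ((Finset.range (w (T + u))).image
        (fun j => h (T + u) + j * m)).card = w (T + u) := by
      intro u _
      rw [Finset.card_image_of_injective, Finset.card_range]
      intro a b hab
      have : a * m = b * m := by simpa using hab
      exact Nat.eq_of_mul_eq_mul_right hm this
    rw [Finset.sum_congr rfl this] at hcard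
    have := S.mono.monotone (show T ≤ T + N by omega)
    omega
  · intro u _ v _ huv
    rw [Function.onFun, Finset.disjoint_left]
    intro c hc hc'
    simp only [Finset.mem_image, Finset.mem_range] at hc hc'
    obtain ⟨j, hj, h1⟩ := hc
    obtain ⟨j', hj', h2⟩ := hc'
    have := blocks_inj S hj hj' (h1.trans h2.symm)
    omega

/-- a periodic word with few long letters has a long run of ones -/
theorem exists_run {N L : ℕ} {w : ℕ → ℕ} (hN : 0 < N) (hper : ∀ t, w (t + N) = w t)
    (hK : 0 < ((Finset.range N).filter (fun u => w u ≠ 1)).card)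
    (hlt : ((Finset.range N).filter (fun u => w u ≠ 1)).card * (L - 1) <
      ((Finset.range N).filter (fun u => w u = 1)).card) :
    ∃ t, ∀ u, 1 ≤ u → u ≤ L → w (t + u) = 1 := by
  by_contra hcon
  push Not at hcon
  have hmod : ∀ t, w (t % N) = w t := by
    intro t
    exact (Function.Periodic.map_mod_nat (f := w) hper t)
  apply absurd hlt
  push Not
  obtain ⟨a, ha⟩ := Finset.card_pos.1 hK
  simp only [Finset.mem_filter, Finset.mem_range] at ha
  classical
  set p : ℕ → ℕ := fun s => Nat.findGreatest (fun c => w c ≠ 1) (s + N) with hp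
  have hp1 : ∀ s, w (p s) ≠ 1 := fun s =>
    Nat.findGreatest_spec (P := fun c => w c ≠ 1) (show a ≤ s + N by omega) ha.2
  have hp2 : ∀ s, p s ≤ s + N := fun s => Nat.findGreatest_le _
  have hp3 : ∀ s c, p s < c → c ≤ s + N → w c = 1 := by
    intro s c h1 h2
    have := Nat.findGreatest_is_greatest h1 h2
    simpa using this
  have hd : ∀ s, s + N - p s < L := by
    intro s
    by_contra h
    push Not at h
    obtain ⟨u, h1, h2, h3⟩ := hcon (p s)
    exact h3 (hp3 s _ (by omega) (by omega))
  have : ((Finset.range N).filter (fun u => w u ≠ 1)).card * (L - 1) =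
    (((Finset.range N).filter (fun u => w u ≠ 1)) ×ˢ (Finset.Ico 1 L)).card := by
    rw [Finset.card_product, Nat.card_Ico]
  rw [this]
  apply Finset.card_le_card_of_injOn (fun s => (p s % N, s + N - p s))
  · intro s hs
    simp only [Finset.coe_filter, Finset.mem_range, Set.mem_ofPred_eq] at hs
    simp only [Finset.coe_product, Set.mem_prod, Finset.coe_filter, Finset.mem_range,
      Set.mem_ofPred_eq, Finset.coe_Ico, Set.mem_Ico]
    refine ⟨⟨Nat.mod_lt _ hN, by rw [hmod]; exact hp1 s⟩, ?_, hd s⟩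
    have : p s ≠ s + N := by
      intro h
      have h1 := hp1 s
      rw [h, hper] at h1
      exact h1 hs.2
    have := hp2 s
    omega
  · intro s hs s' hs' h
    simp only [Finset.coe_filter, Finset.mem_range, Set.mem_ofPred_eq] at hs hs'
    simp only [Prod.mk.injEq] at h
    have e1 : s + N = p s + (s + N - p s) := by have := hp2 s; omega
    have e2 : s' + N = p s' + (s' + N - p s') := by have := hp2 s'; omega
    have : (s + N) % N = (s' + N) % N := by
      rw [e1, e2, Nat.add_mod, h.1, h.2, ← Nat.add_mod]
    rw [Nat.add_mod_right, Nat.add_mod_right, Nat.mod_eq_of_lt hs.1, Nat.mod_eq_of_lt hs'.1] at this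
    exact this

/-- `w` is the word of lengths read off `π`, starting from the head `x` -/
def APRel (n N : ℕ) (π : Finset (ZMod n × ℕ)) (x : ZMod n) (w g : ℕ → ℕ) : Prop :=
  StrictMono g ∧ g 0 = 0 ∧ (∀ t, g (t + N) = g t + n) ∧
  (∀ (c ℓ : ℕ), (x + (c : ZMod n), ℓ) ∈ π → ∃ t, g t = c) ∧
  (∀ t, (x + ((g t : ℕ) : ZMod n), w t) ∈ π)

theorem mem_blockSet {n m : ℕ} {b : ZMod n × ℕ} {z : ZMod n} :
    z ∈ blockSet n m b ↔ ∃ j, j < b.2 ∧ z = b.1 + ((j * m : ℕ) : ZMod n) := by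
  simp only [blockSet, Finset.mem_image, Finset.mem_range]
  constructor
  · rintro ⟨j, h1, h2⟩; exact ⟨j, h1, h2.symm⟩
  · rintro ⟨j, h1, h2⟩; exact ⟨j, h1, h2.symm⟩

theorem block_eq {n m : ℕ} {π : Finset (ZMod n × ℕ)} (hπ : IsAPPartition n m π)
    {b b' : ZMod n × ℕ} (hb : b ∈ π) (hb' : b' ∈ π) {z : ZMod n}
    (h : z ∈ blockSet n m b) (h' : z ∈ blockSet n m b') : b = b' := by
  by_contra hne
  exact Finset.disjoint_left.1 (hπ.2.1 b hb b' hb' hne) h h'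

theorem head_mem {n m : ℕ} {π : Finset (ZMod n × ℕ)} (hπ : IsAPPartition n m π)
    {b : ZMod n × ℕ} (hb : b ∈ π) : b.1 ∈ blockSet n m b :=
  mem_blockSet.2 ⟨0, hπ.1 b hb, by simp⟩

theorem len_eq {n m : ℕ} {π : Finset (ZMod n × ℕ)} (hπ : IsAPPartition n m π)
    {y : ZMod n} {ℓ ℓ' : ℕ} (h : (y, ℓ) ∈ π) (h' : (y, ℓ') ∈ π) : ℓ = ℓ' := by
  have := block_eq hπ h h' (z := y) (head_mem hπ h) (head_mem hπ h')
  exact (Prod.mk.injEq _ _ _ _ ▸ this).2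

theorem APRel.per {n N m : ℕ} {π : Finset (ZMod n × ℕ)} {x : ZMod n} {w g : ℕ → ℕ}
    (hπ : IsAPPartition n m π) (h : APRel n N π x w g) (t : ℕ) : w (t + N) = w t := by
  obtain ⟨h1, h0, h2, h3, h4⟩ := h
  have a := h4 (t + N)
  rw [h2] at a
  simp only [Nat.cast_add, CharP.cast_eq_zero, add_zero] at a
  exact len_eq hπ a (h4 t)

theorem shift_mul {g : ℕ → ℕ} {n N : ℕ} (h : ∀ t, g (t + N) = g t + n) (t q : ℕ) :
    g (t + q * N) = g t + q * n := by
  induction q with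
  | zero => simp
  | succ q ih => rw [Nat.succ_mul, ← add_assoc, h, ih, Nat.succ_mul, add_assoc]

theorem APRel.sys {n N m I : ℕ} {π : Finset (ZMod n × ℕ)} {x : ZMod n} {w g : ℕ → ℕ}
    (hπ : IsAPPartition n m π) (hI : ∀ b ∈ π, b.2 ≤ I) (span : (I - 1) * m < n)
    (h : APRel n N π x w g) : Sys m n g w := by
  obtain ⟨h1, h0, h2, h3, h4⟩ := h
  refine ⟨h1, ?_, ?_⟩
  · intro s t j hst hj he
    have e := block_eq hπ (h4 s) (h4 t) (z := x + ((g t : ℕ) : ZMod n))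
      (mem_blockSet.2 ⟨j, hj, by rw [he]; push_cast; ring⟩) (head_mem hπ (h4 t))
    have e1 : x + ((g s : ℕ) : ZMod n) = x + ((g t : ℕ) : ZMod n) := congrArg Prod.fst e
    rw [he] at e1
    have e2 : ((j * m : ℕ) : ZMod n) = 0 := by
      push_cast at e1 ⊢
      rw [← add_assoc] at e1
      exact (left_eq_add.1 e1)
    rw [ZMod.natCast_eq_zero_iff] at e2
    have e3 : j * m < n := by
      have := hI _ (h4 s)
      simp only at this
      exact lt_of_le_of_lt (Nat.mul_le_mul_right m (by omega)) span
    have e4 := Nat.eq_zero_of_dvd_of_lt e2 e3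
    have := h1 hst
    omega
  · intro c hc
    obtain ⟨⟨y, ℓ⟩, hb, hz⟩ := hπ.2.2 (x + (c : ZMod n))
    obtain ⟨j, hj, hz⟩ := mem_blockSet.1 hz
    simp only at hj hz
    have e3 : j * m < n := by
      have := hI _ hb
      simp only at this
      exact lt_of_le_of_lt (Nat.mul_le_mul_right m (by omega)) span
    have hy : x + ((c - j * m : ℕ) : ZMod n) = y := by
      rw [Nat.cast_sub (by omega), ← add_sub_assoc, hz]
      ring
    obtain ⟨t, ht⟩ := h3 (c - j * m) ℓ (by rw [hy]; exact hb)
    refine ⟨t, j, ?_, by omega⟩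
    have := h4 t
    rw [ht, hy] at this
    rw [len_eq hπ this hb]
    exact hj

theorem APRel.eq_image {n N m : ℕ} [NeZero n] {π : Finset (ZMod n × ℕ)} {x : ZMod n} {w g : ℕ → ℕ}
    (hπ : IsAPPartition n m π) (h : APRel n N π x w g) :
    π = (Finset.range N).image (fun u => (x + ((g u : ℕ) : ZMod n), w u)) ∧
    Set.InjOn (fun u => (x + ((g u : ℕ) : ZMod n), w u)) (Finset.range N : Set ℕ) := by
  obtain ⟨h1, h0, h2, h3, h4⟩ := h
  have hN : g N = n := by have := h2 0; rw [zero_add, h0] at this; omega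
  constructor
  · ext ⟨y, ℓ⟩
    simp only [Finset.mem_image, Finset.mem_range]
    constructor
    · intro hb
      have hy : x + (((y - x).val : ℕ) : ZMod n) = y := by
        rw [ZMod.natCast_zmod_val]; ring
      obtain ⟨t, ht⟩ := h3 (y - x).val ℓ (by rw [hy]; exact hb)
      refine ⟨t, ?_, ?_⟩
      · have := ZMod.val_lt (y - x)
        exact h1.lt_iff_lt.1 (by omega)
      · have e := h4 t
        rw [ht, hy] at e ⊢
        rw [len_eq hπ e hb]
    · rintro ⟨u, _, hu⟩
      rw [← hu]
      exact h4 u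
  · intro u hu v hv huv
    simp only [Finset.coe_range, Set.mem_Iio] at hu hv
    have hu' := h1 hu
    have hv' := h1 hv
    rw [hN] at hu' hv'
    have e : ((g u : ℕ) : ZMod n) = ((g v : ℕ) : ZMod n) := by
      have := congrArg Prod.fst huv
      simpa using this
    rw [ZMod.natCast_eq_natCast_iff', Nat.mod_eq_of_lt hu', Nat.mod_eq_of_lt hv'] at e
    exact h1.injective e

theorem APRel.count {n N m : ℕ} [NeZero n] {π : Finset (ZMod n × ℕ)} {x : ZMod n} {w g : ℕ → ℕ}
    (hπ : IsAPPartition n m π) (h : APRel n N π x w g) (a : ℕ) :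
    (π.filter (fun b => b.2 = a)).card = ((Finset.range N).filter (fun u => w u = a)).card := by
  obtain ⟨e, inj⟩ := h.eq_image hπ
  conv_lhs => rw [e]
  rw [Finset.filter_image, Finset.card_image_of_injOn]
  exact inj.mono (Finset.coe_subset.2 (Finset.filter_subset _ _))

theorem APRel.word_unique {n N m : ℕ} {π : Finset (ZMod n × ℕ)} {x : ZMod n}
    {w g w' g' : ℕ → ℕ} (hπ : IsAPPartition n m π) (h : APRel n N π x w g)
    (h' : APRel n N π x w' g') : w = w' := by
  obtain ⟨h1, h0, h2, h3, h4⟩ := h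
  obtain ⟨h1', h0', h2', h3', h4'⟩ := h'
  have : g = g' := by
    rw [← StrictMono.range_inj h1 h1']
    ext c
    constructor
    · rintro ⟨t, rfl⟩
      exact h3' _ _ (h4 t)
    · rintro ⟨t, rfl⟩
      exact h3 _ _ (h4' t)
  subst this
  ext t
  exact len_eq hπ (h4 t) (h4' t)

theorem APRel.part_unique {n N m I : ℕ} [NeZero n] (hm : 1 ≤ m) (hN : 0 < N)
    {π π' : Finset (ZMod n × ℕ)} {x : ZMod n} {w g g' : ℕ → ℕ}
    (hπ : IsAPPartition n m π) (hπ' : IsAPPartition n m π')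
    (hI : ∀ b ∈ π, b.2 ≤ I) (hI' : ∀ b ∈ π', b.2 ≤ I) (span : (I - 1) * m < n)
    (run : ∃ t, ∀ u, 1 ≤ u → u ≤ (m - 1) * (I - 1) → w (t + u) = 1)
    (h : APRel n N π x w g) (h' : APRel n N π' x w g') : π = π' := by
  have S := h.sys hπ hI span
  have S' := h'.sys hπ' hI' span
  have hwI : ∀ t, w t ≤ I := fun t => hI _ (h.2.2.2.2 t)
  obtain ⟨t, ht⟩ := run
  have per := h.per hπ
  have run' : ∀ u, 1 ≤ u → u ≤ (m - 1) * (I - 1) → w (t + N + u) = 1 := by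
    intro u h1 h2
    rw [show t + N + u = t + u + N by ring, per]
    exact ht u h1 h2
  have c := clean_of_run hm S hwI run'
  have c' := clean_of_run hm S' hwI run'
  set T := t + N + (m - 1) * (I - 1) + 1 with hT
  have gN : g N = n := by have := h.2.2.1 0; rw [zero_add, h.2.1] at this; omega
  have gN' : g' N = n := by have := h'.2.2.1 0; rw [zero_add, h'.2.1] at this; omega
  have U := sys_unique S S' c c' (by rw [← gN]; exact S.mono.monotone (by omega))
    (by rw [← gN']; exact S'.mono.monotone (by omega)) (fun _ => rfl)
  have hge : T ≤ T * N := Nat.le_mul_of_pos_right T hN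
  have hQ : ∀ u, g (T * N + u) + g' T = g' (T * N + u) + g T := by
    intro u
    have := U (T * N - T + u)
    rwa [show T + (T * N - T + u) = T * N + u by omega] at this
  have e1 := shift_mul h.2.2.1
  have e1' := shift_mul h'.2.2.1
  have hT0 := hQ 0
  rw [add_comm _ 0, e1, e1', h.2.1, h'.2.1] at hT0
  have hgg : g = g' := by
    ext u
    have a := hQ u
    rw [add_comm _ u, e1, e1'] at a
    omega
  rw [(h.eq_image hπ).1, (h'.eq_image hπ').1, hgg]

theorem exists_word {n N m : ℕ} [NeZero n] {π : Finset (ZMod n × ℕ)} {x : ZMod n} {ℓ : ℕ}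
    (hπ : IsAPPartition n m π) (hc : π.card = N) (hx : (x, ℓ) ∈ π) :
    ∃ w g, APRel n N π x w g := by
  classical
  have hn : 0 < n := Nat.pos_of_ne_zero (NeZero.ne n)
  set p : ℕ → Prop := fun c => ∃ ℓ, (x + (c : ZMod n), ℓ) ∈ π with hp
  have pper : ∀ c, p (n + c) ↔ p c := by
    intro c; simp [hp]
  have p0 : p 0 := ⟨ℓ, by simpa using hx⟩
  have pmul : ∀ q, p (q * n) := by
    intro q
    exact ⟨ℓ, by simpa using hx⟩
  have inf : (Set.ofPred p).Infinite := by
    rw [Set.infinite_iff_exists_gt]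
    intro a
    refine ⟨(a + 1) * n, pmul _, ?_⟩
    nlinarith
  have hcount : Nat.count p n = N := by
    rw [Nat.count_eq_card_filter_range, ← hc]
    symm
    apply Finset.card_bij (fun b _ => (b.1 - x).val)
    · rintro ⟨y, l⟩ hb
      simp only [Finset.mem_filter, Finset.mem_range]
      refine ⟨ZMod.val_lt _, l, ?_⟩
      rw [ZMod.natCast_zmod_val]
      simpa using hb
    · rintro ⟨y, l⟩ hb ⟨y', l'⟩ hb' h
      have h := ZMod.val_injective n h
      simp only [sub_left_inj] at h
      subst h
      rw [len_eq hπ hb hb']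
    · intro c hc
      simp only [Finset.mem_filter, Finset.mem_range] at hc
      obtain ⟨hc, l, hl⟩ := hc
      refine ⟨_, hl, ?_⟩
      simp [ZMod.val_natCast, Nat.mod_eq_of_lt hc]
  have hcadd : ∀ c, Nat.count p (n + c) = N + Nat.count p c := by
    intro c
    rw [Nat.count_add, hcount]
    simp only [pper]
  have hnth : ∀ t, p (Nat.nth p t) := Nat.nth_mem_of_infinite inf
  choose w hw using hnth
  refine ⟨w, Nat.nth p, Nat.nth_strictMono inf, ?_, ?_, ?_, hw⟩
  · have := Nat.nth_count p0
    simpa using this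
  · intro t
    have a := Nat.nth_count ((pper (Nat.nth p t)).2 ⟨_, hw t⟩)
    rw [hcadd, Nat.count_nth_of_infinite inf] at a
    rw [add_comm t, a, add_comm]
  · intro c l hl
    exact ⟨Nat.count p c, Nat.nth_count ⟨l, hl⟩⟩

theorem exists_part {n N m I : ℕ} [NeZero n] (hm : 1 ≤ m) (hN : 0 < N) (x : ZMod n)
    {w : ℕ → ℕ} (hw1 : ∀ t, 1 ≤ w t) (hI : ∀ t, w t ≤ I) (per : ∀ t, w (t + N) = w t)
    (hsum : ∑ u ∈ Finset.range N, w u = n)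
    (run : ∃ t, ∀ u, 1 ≤ u → u ≤ (m - 1) * (I - 1) → w (t + u) = 1) :
    ∃ π g, IsAPPartition n m π ∧ APRel n N π x w g := by
  obtain ⟨h, S⟩ := exists_sys m w hw1
  obtain ⟨t, run⟩ := run
  have c := clean_of_run hm S hI run
  have run' : ∀ u, 1 ≤ u → u ≤ (m - 1) * (I - 1) → w (t + N + u) = 1 := by
    intro u h1 h2
    rw [show t + N + u = t + u + N by ring, per]
    exact run u h1 h2
  have c' := clean_of_run hm S hI run'
  rw [show t + N + (m - 1) * (I - 1) + 1 = t + (m - 1) * (I - 1) + 1 + N by ring] at c'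
  set T := t + (m - 1) * (I - 1) + 1 with hT
  have hTN := clean_sum hm S c c'
  have hs : ∑ u ∈ Finset.range N, w (T + u) = n := by
    rw [← hsum]
    clear_value T
    clear c c' hTN hT
    induction T with
    | zero => simp
    | succ T ih =>
      rw [← ih]
      have a := Finset.sum_range_succ (fun u => w (T + u)) N
      rw [Finset.sum_range_succ' (fun u => w (T + u)) N] at a
      simp only [per, add_zero] at a
      have : ∑ u ∈ Finset.range N, w (T + 1 + u) = ∑ u ∈ Finset.range N, w (T + (u + 1)) :=
        Finset.sum_congr rfl (fun u _ => by rw [show T + 1 + u = T + (u + 1) by ring])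
      omega
  rw [hs] at hTN
  have U := sys_unique S S c c' (Nat.zero_le _) (Nat.zero_le _)
    (fun u => by rw [show T + N + u = T + u + N by ring, per])
  have hper : ∀ s, T ≤ s → h (s + N) = h s + n := by
    intro s hs
    obtain ⟨v, rfl⟩ := Nat.exists_eq_add_of_le hs
    have := U v
    rw [show T + N + v = T + v + N by ring] at this
    omega
  have hge : T ≤ T * N := Nat.le_mul_of_pos_right T hN
  set Q := T * N with hQ
  have wQ : ∀ u, w (Q + u) = w u := by
    intro u
    have := shift_mul (n := 0) (g := w) per u T
    rw [add_comm]; simpa using this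
  set g : ℕ → ℕ := fun u => h (Q + u) - h Q with hg
  have hgh : ∀ u, h (Q + u) = g u + h Q := by
    intro u
    have := S.mono.monotone (show Q ≤ Q + u by omega)
    simp only [hg]; omega
  have gmono : StrictMono g := by
    intro a b hab
    have := S.mono (show Q + a < Q + b by omega)
    rw [hgh, hgh] at this
    omega
  have g0 : g 0 = 0 := by simp [hg]
  have gper : ∀ u, g (u + N) = g u + n := by
    intro u
    have := hper (Q + u) (by omega)
    rw [add_assoc, hgh, hgh] at this
    omega
  have gN : g N = n := by have := gper 0; rw [zero_add, g0] at this; omega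
  have gshift := shift_mul gper
  have wshift : ∀ u q, w (u + q * N) = w u := by
    intro u q
    have := shift_mul (n := 0) (g := w) per u q
    simpa using this
  set π := (Finset.range N).image (fun u => (x + ((g u : ℕ) : ZMod n), w u)) with hπ
  have hmem : ∀ t, (x + ((g t : ℕ) : ZMod n), w t) ∈ π := by
    intro t
    rw [hπ, Finset.mem_image]
    refine ⟨t % N, Finset.mem_range.2 (Nat.mod_lt _ hN), ?_⟩
    have e : t % N + t / N * N = t := by rw [mul_comm]; exact Nat.mod_add_div t N
    have e1 := gshift (t % N) (t / N)
    have e2 := wshift (t % N) (t / N)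
    rw [e] at e1 e2
    rw [e1, e2]
    simp
  have dis : ∀ u v j j', u < N → v < N → j < w u → j' < w v → g u + j * m ≤ g v + j' * m →
      ((g u + j * m : ℕ) : ZMod n) = ((g v + j' * m : ℕ) : ZMod n) → u = v := by
    intro u v j j' hu hv hj hj' hle he
    rw [ZMod.natCast_eq_natCast_iff] at he
    obtain ⟨q, hq⟩ := (Nat.modEq_iff_dvd' hle).1 he
    have e1 : h (Q + (u + q * N)) + j * m = h (Q + v) + j' * m := by
      rw [hgh, hgh, gshift, mul_comm q n]
      omega
    have e2 := blocks_inj S (by rw [wQ, wshift]; exact hj) (by rw [wQ]; exact hj') e1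
    have e3 : u + q * N = v := by omega
    rcases Nat.eq_zero_or_pos q with rfl | hq0
    · omega
    · have := Nat.le_mul_of_pos_left N hq0
      omega
  refine ⟨π, g, ⟨?_, ?_, ?_⟩, gmono, g0, gper, ?_, hmem⟩
  · intro b hb
    rw [hπ, Finset.mem_image] at hb
    obtain ⟨u, _, rfl⟩ := hb
    exact hw1 u
  · intro b hb b' hb' hne
    rw [hπ, Finset.mem_image] at hb hb'
    obtain ⟨u, hu, rfl⟩ := hb
    obtain ⟨v, hv, rfl⟩ := hb'
    rw [Finset.mem_range] at hu hv
    rw [Finset.disjoint_left]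
    intro z hz hz'
    obtain ⟨j, hj, hz⟩ := mem_blockSet.1 hz
    obtain ⟨j', hj', hz'⟩ := mem_blockSet.1 hz'
    simp only at hj hz hj' hz'
    rw [hz', add_assoc, add_assoc] at hz
    have e := add_left_cancel hz
    have e : ((g u + j * m : ℕ) : ZMod n) = ((g v + j' * m : ℕ) : ZMod n) := by
      rw [Nat.cast_add, Nat.cast_add, e]
    apply hne
    have : u = v := by
      rcases le_total (g u + j * m) (g v + j' * m) with hle | hle
      · exact dis u v j j' hu hv hj hj' hle e
      · exact (dis v u j' j hv hu hj' hj hle e.symm).symm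
    rw [this]
  · intro z
    set c := (z - x).val + (I * m) * n + h Q with hcdef
    obtain ⟨s, j, hj, hc⟩ := S.cover c (Nat.zero_le _)
    have hsQ : Q ≤ s := by
      by_contra hcon
      push Not at hcon
      have a1 := S.mono hcon
      have a2 : j * m ≤ I * m := Nat.mul_le_mul_right m (by have := hI s; omega)
      have a3 : I * m ≤ I * m * n := Nat.le_mul_of_pos_right _ (Nat.pos_of_ne_zero (NeZero.ne n))
      omega
    obtain ⟨v, rfl⟩ := Nat.exists_eq_add_of_le hsQ
    refine ⟨_, hmem v, mem_blockSet.2 ⟨j, by rw [wQ] at hj; exact hj, ?_⟩⟩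
    rw [hgh] at hc
    have e : (z - x).val + (I * m) * n = g v + j * m := by omega
    have e' : (((z - x).val + (I * m) * n : ℕ) : ZMod n) = ((g v + j * m : ℕ) : ZMod n) := by rw [e]
    rw [Nat.cast_add, Nat.cast_mul _ n, ZMod.natCast_zmod_val, ZMod.natCast_self n, mul_zero,
      add_zero, Nat.cast_add] at e'
    rw [add_assoc, ← e']
    ring
  · intro c l hl
    rw [hπ, Finset.mem_image] at hl
    obtain ⟨u, hu, he⟩ := hl
    rw [Finset.mem_range] at hu
    have e : ((g u : ℕ) : ZMod n) = (c : ZMod n) := add_left_cancel (congrArg Prod.fst he)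
    have hgu : g u < n := by rw [← gN]; exact gmono hu
    rw [ZMod.natCast_eq_natCast_iff', Nat.mod_eq_of_lt hgu] at e
    refine ⟨u + c / n * N, ?_⟩
    rw [gshift, e, mul_comm]
    exact Nat.mod_add_div c n

theorem card_words {σ : Type*} [Fintype σ] [DecidableEq σ] (k : σ → ℕ) (N : ℕ)
    (hN : ∑ j, k j = N) :
    (Finset.univ.filter (fun v : Fin N → σ =>
      ∀ j, (Finset.univ.filter (fun u => v u = j)).card = k j)).card =
      Nat.multinomial Finset.univ k := by
  classical
  set d : σ →₀ ℕ := Finsupp.equivFunOnFinite.symm k with hd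
  have h := MvPolynomial.coeff_sum_X_pow_of_fintype (R := ℕ) d N
  have hs : d.sum (fun _ m => m) = N := by
    rw [Finsupp.sum_fintype _ _ (by simp)]
    simpa [hd] using hN
  rw [if_pos hs, Finsupp.multinomial_eq_of_support_subset (Finset.subset_univ d.support)] at h
  have h2 : (d : σ → ℕ) = k := by ext; simp [hd]
  rw [h2] at h
  rw [Nat.cast_id] at h
  rw [← h, ← Fin.prod_const, Finset.prod_univ_sum, MvPolynomial.coeff_sum]
  rw [Finset.card_filter]
  rw [Fintype.piFinset_univ]
  apply Finset.sum_congr rfl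
  intro v _
  have : ∏ u, (MvPolynomial.X (v u) : MvPolynomial σ ℕ) =
      MvPolynomial.monomial (∑ u, Finsupp.single (v u) 1) 1 := by
    rw [MvPolynomial.monomial_sum_one]
    rfl
  rw [this, MvPolynomial.coeff_monomial]
  congr 1
  rw [Finsupp.ext_iff]
  simp [hd, Finsupp.single_apply, eq_comm]

structure WordOK (r N : ℕ) (i k w : ℕ → ℕ) : Prop where
  per : ∀ t, w (t + N) = w t
  lens : ∀ u, u < N → ∃ j, 1 ≤ j ∧ j ≤ r ∧ w u = i j
  cnt : ∀ j, 1 ≤ j → j ≤ r → ((Finset.range N).filter (fun u => w u = i j)).card = k j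

theorem APRel.wordOK {n N m r : ℕ} [NeZero n] {i k : ℕ → ℕ} {π : Finset (ZMod n × ℕ)} {x : ZMod n}
    {w g : ℕ → ℕ} (hπ : IsAPPartition n m π) (ht : HasType n π r i k) (h : APRel n N π x w g) :
    WordOK r N i k w := by
  refine ⟨h.per hπ, ?_, ?_⟩
  · intro u _
    exact ht.1 _ (h.2.2.2.2 u)
  · intro j h1 h2
    rw [← h.count hπ]
    exact ht.2 j h1 h2

theorem APRel.hasType {n N m r : ℕ} [NeZero n] {i k : ℕ → ℕ} {π : Finset (ZMod n × ℕ)} {x : ZMod n}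
    {w g : ℕ → ℕ} (hπ : IsAPPartition n m π) (ok : WordOK r N i k w) (h : APRel n N π x w g) :
    HasType n π r i k := by
  constructor
  · intro b hb
    rw [(h.eq_image hπ).1, Finset.mem_image] at hb
    obtain ⟨u, hu, rfl⟩ := hb
    exact ok.lens u (Finset.mem_range.1 hu)
  · intro j h1 h2
    rw [h.count hπ]
    exact ok.cnt j h1 h2

theorem HasType.card_eq {n r : ℕ} {i k : ℕ → ℕ} {π : Finset (ZMod n × ℕ)}
    (hinj : Set.InjOn i (Finset.Icc 1 r : Set ℕ))
    (ht : HasType n π r i k) : π.card = ∑ j ∈ Finset.Icc 1 r, k j := by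
  have hmaps : Set.MapsTo Prod.snd (π : Set (ZMod n × ℕ)) ((Finset.Icc 1 r).image i : Set ℕ) := by
    intro b hb
    obtain ⟨j, h1, h2, h3⟩ := ht.1 b hb
    exact Finset.mem_coe.2 (Finset.mem_image.2 ⟨j, Finset.mem_Icc.2 ⟨h1, h2⟩, h3.symm⟩)
  rw [Finset.card_eq_sum_card_fiberwise (t := (Finset.Icc 1 r).image i) hmaps,
    Finset.sum_image hinj]
  apply Finset.sum_congr rfl
  intro j hj
  rw [Finset.mem_Icc] at hj
  exact ht.2 j hj.1 hj.2

theorem WordOK.sum_eq {r N : ℕ} {i k w : ℕ → ℕ}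
    (hinj : Set.InjOn i (Finset.Icc 1 r : Set ℕ)) (ok : WordOK r N i k w) :
    ∑ u ∈ Finset.range N, w u = ∑ j ∈ Finset.Icc 1 r, k j * i j := by
  have hmaps : ∀ u ∈ Finset.range N, w u ∈ (Finset.Icc 1 r).image i := by
    intro u hu
    obtain ⟨j, h1, h2, h3⟩ := ok.lens u (Finset.mem_range.1 hu)
    exact Finset.mem_image.2 ⟨j, Finset.mem_Icc.2 ⟨h1, h2⟩, h3.symm⟩
  rw [← Finset.sum_fiberwise_of_maps_to hmaps, Finset.sum_image hinj]
  apply Finset.sum_congr rfl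
  intro j hj
  rw [Finset.mem_Icc] at hj
  rw [← ok.cnt j hj.1 hj.2, Finset.sum_const_nat (m := i j)]
  intro u hu
  exact (Finset.mem_filter.1 hu).2

theorem WordOK.len_all {r N : ℕ} {i k w : ℕ → ℕ} (hN : 0 < N) (ok : WordOK r N i k w) (t : ℕ) :
    ∃ j, 1 ≤ j ∧ j ≤ r ∧ w t = i j := by
  have : w (t % N) = w t := Function.Periodic.map_mod_nat (f := w) ok.per t
  rw [← this]
  exact ok.lens _ (Nat.mod_lt _ hN)

/-- the periodic word of lengths associated with a word of indices -/
def toWord {r N : ℕ} (hN : 0 < N) (i : ℕ → ℕ) (v : Fin N → Finset.Icc 1 r) (t : ℕ) : ℕ :=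
  i (v ⟨t % N, Nat.mod_lt _ hN⟩)

theorem toWord_count {r N : ℕ} (hN : 0 < N) {i : ℕ → ℕ}
    (hinj : Set.InjOn i (Finset.Icc 1 r : Set ℕ)) (v : Fin N → Finset.Icc 1 r)
    (j : Finset.Icc 1 r) :
    ((Finset.range N).filter (fun u => toWord hN i v u = i j)).card =
      (Finset.univ.filter (fun u => v u = j)).card := by
  symm
  apply Finset.card_bij (fun (u : Fin N) _ => (u : ℕ))
  · intro u hu
    simp only [Finset.mem_filter, Finset.mem_univ, true_and] at hu
    simp only [Finset.mem_filter, Finset.mem_range]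
    refine ⟨u.2, ?_⟩
    simp only [toWord, Nat.mod_eq_of_lt u.2, Fin.eta, hu]
  · intro a _ b _ h
    exact Fin.ext h
  · intro u hu
    simp only [Finset.mem_filter, Finset.mem_range] at hu
    refine ⟨⟨u, hu.1⟩, ?_, rfl⟩
    simp only [Finset.mem_filter, Finset.mem_univ, true_and]
    have := hu.2
    simp only [toWord, Nat.mod_eq_of_lt hu.1] at this
    exact Subtype.ext (hinj (Finset.mem_coe.2 (Subtype.prop _)) (Finset.mem_coe.2 j.2) this)

theorem toWord_injective {r N : ℕ} (hN : 0 < N) {i : ℕ → ℕ}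
    (hinj : Set.InjOn i (Finset.Icc 1 r : Set ℕ)) :
    Function.Injective (toWord (r := r) hN i) := by
  intro v v' h
  ext u
  have := congrFun h u
  simp only [toWord, Nat.mod_eq_of_lt u.2, Fin.eta] at this
  exact hinj (Finset.mem_coe.2 (Subtype.prop _)) (Finset.mem_coe.2 (Subtype.prop _)) this

theorem toWord_ok {r N : ℕ} (hN : 0 < N) {i k : ℕ → ℕ}
    (hinj : Set.InjOn i (Finset.Icc 1 r : Set ℕ)) (v : Fin N → Finset.Icc 1 r)
    (hv : ∀ j : Finset.Icc 1 r, (Finset.univ.filter (fun u => v u = j)).card = k j) :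
    WordOK r N i k (toWord hN i v) := by
  refine ⟨?_, ?_, ?_⟩
  · intro t
    simp [toWord]
  · intro u _
    have := Finset.mem_Icc.1 (v ⟨u % N, Nat.mod_lt _ hN⟩).2
    exact ⟨_, this.1, this.2, rfl⟩
  · intro j h1 h2
    have hj : j ∈ Finset.Icc 1 r := Finset.mem_Icc.2 ⟨h1, h2⟩
    rw [← hv ⟨j, hj⟩, ← toWord_count hN hinj v ⟨j, hj⟩]

theorem exists_toWord {r N : ℕ} (hN : 0 < N) {i k w : ℕ → ℕ}
    (hinj : Set.InjOn i (Finset.Icc 1 r : Set ℕ)) (ok : WordOK r N i k w) :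
    ∃ v : Fin N → Finset.Icc 1 r, toWord hN i v = w ∧
      ∀ j : Finset.Icc 1 r, (Finset.univ.filter (fun u => v u = j)).card = k j := by
  have : ∀ u : Fin N, ∃ j : Finset.Icc 1 r, w u = i j := by
    intro u
    obtain ⟨j, h1, h2, h3⟩ := ok.lens u u.2
    exact ⟨⟨j, Finset.mem_Icc.2 ⟨h1, h2⟩⟩, h3⟩
  choose v hv using this
  have e : toWord hN i v = w := by
    ext t
    rw [toWord, ← hv]
    exact Function.Periodic.map_mod_nat (f := w) ok.per t
  refine ⟨v, e, ?_⟩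
  intro j
  rw [← toWord_count hN hinj, e]
  have := Finset.mem_Icc.1 j.2
  exact ok.cnt j this.1 this.2

/-- **Main theorem (Chen–Wang–Zhang).**  Given `m ≥ 1` and a type
`1 ^ k 1 (i 2) ^ k 2 ⋯ (i r) ^ k r` with `r ≥ 2`, `1 = i 1 < i 2 < ⋯ < i r`, all
`k j ≥ 1`, and `n = k 1 + ∑_{j=2}^{r} k j * i j`, if
`⌈k 1 / (k 2 + ⋯ + k r)⌉ ≥ (m - 1) * (i r - 1)` then the number of `m`-AP-partitions of
`ZMod n` of this type is independent of `m` and equals the cyclic multinomial coefficient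
`(n / (k 1 + ⋯ + k r)) * (k 1 + ⋯ + k r)! / (k 1 ! ⋯ k r !)`. -/
theorem statement5 (m r : ℕ) (i k : ℕ → ℕ) (hm : 1 ≤ m) (hr : 2 ≤ r)
    (hi1 : i 1 = 1)
    (hmono : ∀ j, 1 ≤ j → j < r → i j < i (j + 1))
    (hk : ∀ j, 1 ≤ j → j ≤ r → 1 ≤ k j)
    (n : ℕ) (hn : n = k 1 + ∑ j ∈ Finset.Icc 2 r, k j * i j)
    (hcond : (((m - 1) * (i r - 1) : ℕ) : ℤ) ≤
      ⌈(k 1 : ℚ) / ((∑ j ∈ Finset.Icc 2 r, k j : ℕ) : ℚ)⌉) :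
    ({π : Finset (ZMod n × ℕ) | IsAPPartition n m π ∧ HasType n π r i k}.ncard : ℚ) =
      (n : ℚ) / ((∑ j ∈ Finset.Icc 1 r, k j : ℕ) : ℚ) *
        (Nat.multinomial (Finset.Icc 1 r) k : ℚ) := by
  classical
  -- elementary facts on the lengths
  have hlt : ∀ a b, 1 ≤ a → a < b → b ≤ r → i a < i b := by
    intro a b ha hab
    induction b, hab using Nat.le_induction with
    | base => intro h; exact hmono a ha (by omega)
    | succ b hb ih =>
      intro h
      have hab : a < b := hb
      exact (ih (by omega)).trans (hmono b (by omega) (by omega))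
  have hinj : Set.InjOn i (Finset.Icc 1 r : Set ℕ) := by
    intro a ha b hb hab
    simp only [Finset.coe_Icc, Set.mem_Icc] at ha hb
    rcases lt_trichotomy a b with h | h | h
    · exact absurd hab (hlt a b ha.1 h hb.2).ne
    · exact h
    · exact absurd hab.symm (hlt b a hb.1 h ha.2).ne
  have hle : ∀ a, 1 ≤ a → a ≤ r → i a ≤ i r := by
    intro a h1 h2
    rcases Nat.lt_or_eq_of_le h2 with h | h
    · exact (hlt a r h1 h le_rfl).le
    · rw [h]
  have hge : ∀ a, 1 ≤ a → a ≤ r → 1 ≤ i a := by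
    intro a h1 h2
    rcases Nat.lt_or_eq_of_le h1 with h | h
    · have := hlt 1 a le_rfl h h2
      omega
    · rw [← h, hi1]
  have hsplit : ∀ f : ℕ → ℕ, ∑ j ∈ Finset.Icc 1 r, f j = f 1 + ∑ j ∈ Finset.Icc 2 r, f j := by
    intro f
    rw [← Finset.add_sum_Ioc_eq_sum_Icc (by omega : 1 ≤ r)]
    rfl
  set K := ∑ j ∈ Finset.Icc 2 r, k j with hK
  set N := ∑ j ∈ Finset.Icc 1 r, k j with hNdef
  have hNK : N = k 1 + K := hsplit k
  have hn' : n = ∑ j ∈ Finset.Icc 1 r, k j * i j := by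
    rw [hsplit, hi1, mul_one, hn]
  have hk1 := hk 1 le_rfl (by omega)
  have hN : 0 < N := by omega
  have hK1 : 1 ≤ K := (hk 2 (by omega) hr).trans
    (Finset.single_le_sum (f := k) (fun _ _ => Nat.zero_le _) (Finset.mem_Icc.2 ⟨le_rfl, hr⟩))
  set L := (m - 1) * (i r - 1) with hL
  have hcond' : ((L : ℚ) - 1) * K < k 1 := by
    rw [Int.le_ceil_iff] at hcond
    rw [lt_div_iff₀ (by exact_mod_cast hK1)] at hcond
    exact_mod_cast hcond
  have hKL : K * (L - 1) < k 1 := by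
    rcases Nat.eq_zero_or_pos L with h | h
    · rw [h]; omega
    · have : (((L - 1 : ℕ) : ℚ)) * K < k 1 := by
        rw [Nat.cast_sub h]; exact_mod_cast hcond'
      rw [mul_comm]
      exact_mod_cast this
  have hLk : L ≤ k 1 := by
    have : L - 1 ≤ K * (L - 1) := Nat.le_mul_of_pos_left _ hK1
    omega
  have span : (i r - 1) * m < n := by
    have h1 : k r * i r ≤ ∑ j ∈ Finset.Icc 2 r, k j * i j :=
      Finset.single_le_sum (f := fun j => k j * i j) (fun _ _ => Nat.zero_le _)
        (Finset.mem_Icc.2 ⟨hr, le_rfl⟩)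
    have h2 : i r ≤ k r * i r := Nat.le_mul_of_pos_left _ (hk r (by omega) le_rfl)
    have h3 : (i r - 1) * m = L + (i r - 1) := by
      obtain ⟨m', rfl⟩ : ∃ m', m = m' + 1 := ⟨m - 1, by omega⟩
      rw [hL, Nat.add_sub_cancel]; ring
    have h4 := hge r (by omega) le_rfl
    omega
  have hnpos : 0 < n := by omega
  have : NeZero n := ⟨by omega⟩
  have : Nonempty (Finset.Icc 1 r) := ⟨⟨1, Finset.mem_Icc.2 ⟨le_rfl, by omega⟩⟩⟩
  -- every admissible word has a long run of ones
  have run : ∀ w, WordOK r N i k w → ∃ t, ∀ u, 1 ≤ u → u ≤ L → w (t + u) = 1 := by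
    intro w ok
    have c1 := ok.cnt 1 le_rfl (by omega)
    rw [hi1] at c1
    have c2 := Finset.card_filter_add_card_filter_not (s := Finset.range N) (fun u => w u = 1)
    rw [Finset.card_range, c1] at c2
    have c3 : ((Finset.range N).filter (fun u => w u ≠ 1)).card = K := by
      have : ((Finset.range N).filter (fun u => w u ≠ 1)).card =
        ((Finset.range N).filter (fun u => ¬ w u = 1)).card := rfl
      omega
    exact exists_run hN ok.per (by omega) (by rw [c3, c1]; exact hKL)
  set S := {π : Finset (ZMod n × ℕ) | IsAPPartition n m π ∧ HasType n π r i k} with hS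
  have hbI : ∀ π, HasType n π r i k → ∀ b ∈ π, b.2 ≤ i r := by
    intro π h b hb
    obtain ⟨j, h1, h2, h3⟩ := h.1 b hb
    rw [h3]
    exact hle j h1 h2
  have hfin : S.Finite := by
    apply Set.Finite.subset (Finset.finite_toSet
      ((Finset.univ ×ˢ Finset.range (i r + 1) : Finset (ZMod n × ℕ)).powerset))
    intro π hπ
    rw [Finset.mem_coe, Finset.mem_powerset]
    intro b hb
    have := hbI π hπ.2 b hb
    simp only [Finset.mem_product, Finset.mem_univ, true_and, Finset.mem_range]
    omega
  set F := hfin.toFinset with hF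
  have hFm : ∀ π, π ∈ F ↔ IsAPPartition n m π ∧ HasType n π r i k := by
    intro π
    rw [hF, Set.Finite.mem_toFinset, hS]
    rfl
  set W := Finset.univ.filter (fun v : Fin N → Finset.Icc 1 r =>
      ∀ j, (Finset.univ.filter (fun u => v u = j)).card = k j) with hW
  have hWcard : W.card = Nat.multinomial (Finset.Icc 1 r) k := by
    have h1 := card_words (σ := Finset.Icc 1 r) (fun j => k j) N
      (Finset.sum_coe_sort (Finset.Icc 1 r) k)
    rw [hW, h1]
    simp only [Nat.multinomial]
    rw [Finset.sum_coe_sort (Finset.Icc 1 r) k,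
      Finset.prod_coe_sort (Finset.Icc 1 r) (fun j => (k j).factorial)]
  set A := F.sigma (fun π => π) with hA
  set B := W ×ˢ (Finset.univ : Finset (ZMod n)) with hB
  have hAcard : A.card = F.card * N := by
    rw [hA, Finset.card_sigma]
    apply Finset.sum_const_nat
    intro π hπ
    exact ((hFm π).1 hπ).2.card_eq hinj
  have hBcard : B.card = W.card * n := by
    rw [hB, Finset.card_product, Finset.card_univ, ZMod.card]
  have hAB : A.card = B.card := by
    apply le_antisymm
    · have ex : ∀ a : (Σ _ : Finset (ZMod n × ℕ), ZMod n × ℕ), a ∈ A →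
          ∃ v ∈ W, ∃ g, APRel n N a.1 a.2.1 (toWord hN i v) g := by
        rintro ⟨π, x, l⟩ ha
        rw [hA, Finset.mem_sigma] at ha
        obtain ⟨hπ, hx⟩ := ha
        simp only at hπ hx
        obtain ⟨hπ, ht⟩ := (hFm π).1 hπ
        obtain ⟨w, g, hrel⟩ := exists_word hπ (ht.card_eq hinj) hx
        obtain ⟨v, hv, hv2⟩ := exists_toWord hN hinj (hrel.wordOK hπ ht)
        refine ⟨v, by simpa [hW] using hv2, g, ?_⟩
        rw [hv]
        exact hrel
      choose! v hv g hg using ex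
      apply Finset.card_le_card_of_injOn (fun a => (v a, a.2.1))
      · intro a ha
        simp only [hB, Finset.coe_product, Set.mem_prod, Finset.coe_univ, Set.mem_univ, and_true]
        exact hv a ha
      · rintro ⟨π, x, l⟩ ha ⟨π', x', l'⟩ ha' h
        have g1 := hg _ ha
        have g2 := hg _ ha'
        have w1 := hv _ ha
        simp only [Prod.mk.injEq] at h
        obtain ⟨h1, rfl⟩ := h
        rw [← h1] at g2
        rw [hA, Finset.mem_coe, Finset.mem_sigma] at ha ha'
        obtain ⟨hπ, ht⟩ := (hFm π).1 ha.1
        obtain ⟨hπ', ht'⟩ := (hFm π').1 ha'.1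
        have ok := toWord_ok hN hinj _ (by simpa [hW] using w1)
        have e := g1.part_unique hm hN hπ hπ' (hbI π ht) (hbI π' ht') span (run _ ok) g2
        subst e
        have := len_eq hπ ha.2 ha'.2
        subst this
        rfl
    · have ex : ∀ b : (Fin N → Finset.Icc 1 r) × ZMod n, b ∈ B →
          ∃ a : (Σ _ : Finset (ZMod n × ℕ), ZMod n × ℕ), a ∈ A ∧ a.2.1 = b.2 ∧
            ∃ g, APRel n N a.1 b.2 (toWord hN i b.1) g := by
        rintro ⟨v, x⟩ hb
        rw [hB, Finset.mem_product] at hb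
        have ok := toWord_ok (k := k) hN hinj v (by simpa [hW] using hb.1)
        have hw1 : ∀ t, 1 ≤ toWord hN i v t := by
          intro t
          obtain ⟨j, h1, h2, h3⟩ := ok.len_all hN t
          rw [h3]; exact hge j h1 h2
        have hwI : ∀ t, toWord hN i v t ≤ i r := by
          intro t
          obtain ⟨j, h1, h2, h3⟩ := ok.len_all hN t
          rw [h3]; exact hle j h1 h2
        obtain ⟨π, g, hπ, hrel⟩ := exists_part hm hN x hw1 hwI ok.per
          ((ok.sum_eq hinj).trans hn'.symm) (run _ ok)
        refine ⟨⟨π, x, toWord hN i v 0⟩, ?_, rfl, g, hrel⟩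
        rw [hA, Finset.mem_sigma]
        refine ⟨(hFm π).2 ⟨hπ, hrel.hasType hπ ok⟩, ?_⟩
        have := hrel.2.2.2.2 0
        rw [hrel.2.1] at this
        simpa using this
      choose! a ha hax g hg using ex
      apply Finset.card_le_card_of_injOn a
      · intro b hb
        exact ha b hb
      · rintro ⟨v, x⟩ hb ⟨v', x'⟩ hb' h
        have g1 := hg _ hb
        have g2 := hg _ hb'
        have x1 := hax _ hb
        have x2 := hax _ hb'
        have m1 := ha _ hb
        simp only at g1 g2 x1 x2 m1
        rw [← h] at g2 x2
        have hx : x = x' := x1.symm.trans x2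
        subst hx
        rw [hA, Finset.mem_sigma] at m1
        obtain ⟨hπ, _⟩ := (hFm _).1 m1.1
        have := toWord_injective hN hinj (g1.word_unique hπ g2)
        rw [this]
  have hfinal : F.card * N = W.card * n := by rw [← hAcard, ← hBcard, hAB]
  rw [Set.ncard_eq_toFinset_card S hfin, ← hF, ← hWcard]
  have hNq : (N : ℚ) ≠ 0 := by exact_mod_cast hN.ne'
  rw [div_mul_eq_mul_div, eq_div_iff hNq]
  have : (F.card : ℚ) * N = W.card * n := by exact_mod_cast hfinal
  rw [this, mul_comm]
end

section
/- Let m ≥ 1, let r ≥ 2, let 1 < i_2 < ⋯ < i_r be integers, let k_1, …, k_r ≥ 1, let n = k_1 + k_2·i_2 + ⋯ + k_r·i_r, and assume ⌈k_1/(k_2 + ⋯ + k_r)⌉ ≥ (m − 1)(i_r − 1). For s ∈ {2, …, r}, there exist two distinct m-AP-blocks of Z_n of length i_s having the same underlying set if and only if s = r and n = i_r · m. Consequently, under this condition every m-AP-block of length belonging to {1, i_2, …, i_r} is uniquely determined by its underlying set unless n = i_r m and the block has length i_r. -/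
theorem aux_arith (n m l p d : ℕ) (hm : 1 ≤ m) (hp : 2 ≤ p) (hn : m * (p - 1) < n) (hl : l ≤ p)
    (hd1 : 1 ≤ d) (hd : d ≤ l) (h : n ∣ d * m) : l = p ∧ n = p * m := by
  obtain ⟨g, n', m', hg, hcop, rfl, rfl⟩ := Nat.exists_coprime' (m := n) (n := m)
    (Nat.gcd_pos_of_pos_right _ hm)
  obtain ⟨q, rfl⟩ : ∃ q, p = q + 2 := ⟨p - 2, by omega⟩
  have e : q + 2 - 1 = q + 1 := by omega
  rw [e] at hn
  have h1 : n' ∣ d * m' := by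
    rw [← mul_assoc] at h
    exact Nat.dvd_of_mul_dvd_mul_right hg h
  have h2 : n' ≤ d := Nat.le_of_dvd hd1 (hcop.dvd_of_dvd_mul_right h1)
  have h3 : m' * (q + 1) < n' := by
    by_contra hc
    push Not at hc
    have := Nat.mul_le_mul_right g hc
    nlinarith
  have hm' : 1 ≤ m' := by
    rcases Nat.eq_zero_or_pos m' with h0 | h0
    · subst h0; omega
    · exact h0
  have h4 : m' = 1 := by
    by_contra hc
    have : 2 ≤ m' := by omega
    nlinarith
  subst h4
  have h5 : n' = q + 2 := by omega
  subst h5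
  refine ⟨by omega, by ring⟩

theorem aux_block (n m l : ℕ) (x y : ZMod n) (hl : 1 ≤ l) (hxy : x ≠ y)
    (h : blockSet n m (x, l) = blockSet n m (y, l)) : ∃ d, 1 ≤ d ∧ d ≤ l ∧ n ∣ d * m := by
  have mem : ∀ (z w : ZMod n), z ∈ blockSet n m (w, l) ↔
      ∃ j < l, w + ((j * m : ℕ) : ZMod n) = z := by
    intro z w
    simp [blockSet]
  have hy : y ∈ blockSet n m (x, l) := by
    rw [h, mem]
    exact ⟨0, hl, by simp⟩
  obtain ⟨a, hal, ha⟩ := (mem _ _).1 hy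
  have ha0 : a ≠ 0 := by
    rintro rfl
    apply hxy
    simpa using ha
  have hz : x + ((l * m : ℕ) : ZMod n) ∈ blockSet n m (x, l) := by
    rw [h, mem]
    refine ⟨l - a, by omega, ?_⟩
    rw [← ha, add_assoc, ← Nat.cast_add, ← Nat.add_mul]
    congr 3
    omega
  obtain ⟨c, hcl, hc⟩ := (mem _ _).1 hz
  have hc' := add_left_cancel hc
  refine ⟨l - c, by omega, by omega, ?_⟩
  rw [Nat.sub_mul]
  exact (Nat.modEq_iff_dvd' (Nat.mul_le_mul_right m hcl.le)).1
    ((ZMod.natCast_eq_natCast_iff _ _ _).1 hc')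

theorem aux_full (n m p : ℕ) (hp : 2 ≤ p) (hn : n = p * m) :
    blockSet n m (0, p) = blockSet n m ((m : ZMod n), p) := by
  have hz : ((p * m : ℕ) : ZMod n) = 0 := by rw [← hn]; simp
  ext z
  simp only [blockSet, Finset.mem_image, Finset.mem_range]
  constructor
  · rintro ⟨j, hj, rfl⟩
    rcases Nat.eq_zero_or_pos j with rfl | h0
    · refine ⟨p - 1, by omega, ?_⟩
      rw [← Nat.cast_add]
      have : m + (p - 1) * m = p * m := by
        obtain ⟨q, rfl⟩ : ∃ q, p = q + 1 := ⟨p - 1, by omega⟩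
        simp; ring
      rw [this, hz]; simp
    · obtain ⟨q, rfl⟩ : ∃ q, j = q + 1 := ⟨j - 1, by omega⟩
      exact ⟨q, by omega, by push_cast; ring⟩
  · rintro ⟨j, hj, rfl⟩
    by_cases h : j + 1 < p
    · exact ⟨j + 1, h, by push_cast; ring⟩
    · obtain rfl : p = j + 1 := by omega
      refine ⟨0, by omega, ?_⟩
      rw [← Nat.cast_add, show m + j * m = (j + 1) * m by ring, hz]; simp

/-- **Proposition 2 of Chen–Wang–Zhang.**  Under the technical condition
`⌈k 1 / (k 2 + ⋯ + k r)⌉ ≥ (m - 1) * (i r - 1)` (with `r ≥ 2`, `1 = i 1 < i 2 < ⋯ < i r`,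
all `k j ≥ 1`, `n = k 1 + ∑_{j=2}^{r} k j * i j`), for every `s` with `2 ≤ s ≤ r` there
exist two distinct `m`-AP-blocks of `ZMod n` of length `i s` (i.e. with distinct heads)
having the same underlying set if and only if `s = r` and `n = i r * m`.  Consequently an
`m`-AP-block whose length lies in `{1, i 2, …, i r}` is uniquely determined by its
underlying set unless `n = i r * m` and the block has length `i r`. -/
theorem statement6 (m r : ℕ) (i k : ℕ → ℕ) (hm : 1 ≤ m) (hr : 2 ≤ r)
    (hi1 : i 1 = 1)
    (hmono : ∀ j, 1 ≤ j → j < r → i j < i (j + 1))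
    (hk : ∀ j, 1 ≤ j → j ≤ r → 1 ≤ k j)
    (n : ℕ) (hn : n = k 1 + ∑ j ∈ Finset.Icc 2 r, k j * i j)
    (hcond : (((m - 1) * (i r - 1) : ℕ) : ℤ) ≤
      ⌈(k 1 : ℚ) / ((∑ j ∈ Finset.Icc 2 r, k j : ℕ) : ℚ)⌉) :
    (∀ s, 2 ≤ s → s ≤ r →
      ((∃ x y : ZMod n, x ≠ y ∧ blockSet n m (x, i s) = blockSet n m (y, i s)) ↔
        (s = r ∧ n = i r * m))) ∧
    (∀ l, (l = 1 ∨ ∃ s, 2 ≤ s ∧ s ≤ r ∧ l = i s) → ¬(l = i r ∧ n = i r * m) →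
      ∀ x y : ZMod n, blockSet n m (x, l) = blockSet n m (y, l) → x = y) := by
  have hlt : ∀ t, ∀ s, 1 ≤ s → s + t + 1 ≤ r → i s < i (s + t + 1) := by
    intro t
    induction t with
    | zero => intro s h1 h2; exact hmono s h1 (by omega)
    | succ t ih =>
      intro s h1 h2
      exact (ih s h1 (by omega)).trans (hmono (s + t + 1) (by omega) (by omega))
  have hlt' : ∀ s u, 1 ≤ s → s < u → u ≤ r → i s < i u := by
    intro s u h1 h2 h3
    obtain ⟨t, rfl⟩ : ∃ t, u = s + t + 1 := ⟨u - s - 1, by omega⟩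
    exact hlt t s h1 h3
  have hpos : ∀ s, 2 ≤ s → s ≤ r → 2 ≤ i s := by
    intro s h1 h2
    have := hlt' 1 s le_rfl (by omega) h2
    omega
  have hle : ∀ s, 2 ≤ s → s ≤ r → i s ≤ i r := by
    intro s h1 h2
    rcases h2.eq_or_lt with rfl | h
    · exact le_rfl
    · exact (hlt' s r (by omega) h le_rfl).le
  have hp := hpos r hr le_rfl
  have hkey : m * (i r - 1) < n := by
    have hsplit : Finset.Icc 2 r = insert r (Finset.Icc 2 (r - 1)) := by
      ext t; simp; omega
    have hnot : r ∉ Finset.Icc 2 (r - 1) := by simp; omega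
    have hS : ∑ j ∈ Finset.Icc 2 (r - 1), k j ≤ ∑ j ∈ Finset.Icc 2 (r - 1), k j * i j := by
      apply Finset.sum_le_sum
      intro j hj
      rw [Finset.mem_Icc] at hj
      have := hpos j hj.1 (by omega)
      nlinarith
    have hkr := hk r (by omega) le_rfl
    have hk1 := hk 1 le_rfl (by omega)
    rw [hsplit, Finset.sum_insert hnot] at hn hcond
    generalize ∑ j ∈ Finset.Icc 2 (r - 1), k j = A at *
    generalize ∑ j ∈ Finset.Icc 2 (r - 1), k j * i j = B at *
    obtain ⟨q, hq⟩ : ∃ q, i r = q + 2 := ⟨i r - 2, by omega⟩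
    obtain ⟨m', rfl⟩ : ∃ m', m = m' + 1 := ⟨m - 1, by omega⟩
    rw [hq] at hn hcond ⊢
    have e : q + 2 - 1 = q + 1 := by omega
    rw [e] at hcond ⊢
    rw [Nat.add_sub_cancel] at hcond
    have hKpos : (0 : ℚ) < ((k r + A : ℕ) : ℚ) := by exact_mod_cast (by omega)
    have h1 : (((m' * (q + 1) : ℕ) : ℤ) : ℚ) - 1 < (k 1 : ℚ) / ((k r + A : ℕ) : ℚ) := by
      have h2 := Int.ceil_lt_add_one ((k 1 : ℚ) / ((k r + A : ℕ) : ℚ))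
      have h3 : (((m' * (q + 1) : ℕ) : ℤ) : ℚ) ≤ (⌈(k 1 : ℚ) / ((k r + A : ℕ) : ℚ)⌉ : ℚ) := by
        exact_mod_cast hcond
      linarith
    rw [lt_div_iff₀ hKpos] at h1
    have h4 : m' * (q + 1) * (k r + A) < k 1 + (k r + A) := by
      have : ((m' * (q + 1) * (k r + A) : ℕ) : ℚ) < ((k 1 + (k r + A) : ℕ) : ℚ) := by
        push_cast at h1 ⊢
        linarith
      exact_mod_cast this
    obtain ⟨w, hw⟩ : ∃ w, k r = w + 1 := ⟨k r - 1, by omega⟩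
    rw [hw] at h4 hn
    have h5 : m' * (q + 1) ≤ m' * (q + 1) * (w + 1 + A) := Nat.le_mul_of_pos_right _ (by omega)
    rw [hn]
    nlinarith [Nat.zero_le (w * q)]
  have main : ∀ s, 2 ≤ s → s ≤ r → ∀ x y : ZMod n, x ≠ y →
      blockSet n m (x, i s) = blockSet n m (y, i s) → i s = i r ∧ n = i r * m := by
    intro s h1 h2 x y hxy h
    have := hpos s h1 h2
    obtain ⟨d, hd1, hd2, hd⟩ := aux_block n m (i s) x y (by omega) hxy h
    exact aux_arith n m (i s) (i r) d hm hp hkey (hle s h1 h2) hd1 hd2 hd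
  refine ⟨?_, ?_⟩
  · intro s h1 h2
    constructor
    · rintro ⟨x, y, hxy, h⟩
      obtain ⟨ha, hb⟩ := main s h1 h2 x y hxy h
      refine ⟨?_, hb⟩
      by_contra hne
      have := hlt' s r (by omega) (by omega) le_rfl
      omega
    · rintro ⟨rfl, h⟩
      refine ⟨0, (m : ZMod n), ?_, aux_full n m _ hp h⟩
      intro h0
      have hd := (ZMod.natCast_eq_zero_iff m n).1 h0.symm
      have := Nat.le_of_dvd (by omega) hd
      nlinarith
  · rintro l (rfl | ⟨s, h1, h2, rfl⟩) hno x y h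
    · simpa [blockSet] using h
    · by_contra hxy
      exact hno (main s h1 h2 x y hxy h)
end

section
/- Let m, m' ≥ 1, let r ≥ 2, let 1 < i_2 < ⋯ < i_r be integers, let k_1, …, k_r ≥ 1, and let n = k_1 + k_2·i_2 + ⋯ + k_r·i_r. Assume the condition ⌈k_1/(k_2 + ⋯ + k_r)⌉ ≥ (max{m, m'} − 1)(i_r − 1). Then there is a bijection between the set P_m of m-AP-partitions of Z_n of type T = 1^{k_1} i_2^{k_2} ⋯ i_r^{k_r} and the set P_{m'} of m'-AP-partitions of Z_n of type T; in particular |P_m| = |P_{m'}|. -/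
/-- `p` enumerates increasingly the heads of a partition of `ℕ` into `m`-AP-blocks whose
successive lengths are `w`. -/
structure LinPart (m : ℕ) (w p : ℕ → ℕ) : Prop where
  mono : StrictMono p
  cover : ∀ z, ∃ t j, j < w t ∧ z = p t + j * m
  uniq : ∀ t t' j j', j < w t → j' < w t' → p t + j * m = p t' + j' * m → t = t'

noncomputable def greedyHead (m : ℕ) (w : ℕ → ℕ) : ℕ → ℕ
  | t => sInf {z | ∀ s, (h : s < t) → ∀ j < w s, z ≠ greedyHead m w s + j * m}
decreasing_by exact h

lemma linPart_greedyHead (m : ℕ) (w : ℕ → ℕ) (hw : ∀ t, 1 ≤ w t) :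
    LinPart m w (greedyHead m w) := by
  classical
  set p := greedyHead m w with hp
  have hdef : ∀ t, p t = sInf {z | ∀ s, s < t → ∀ j < w s, z ≠ p s + j * m} := by
    intro t
    rw [hp, greedyHead]
  have hne : ∀ t, {z | ∀ s, s < t → ∀ j < w s, z ≠ p s + j * m}.Nonempty := by
    intro t
    let S := (Finset.range t).biUnion fun s => (Finset.range (w s)).image fun j => p s + j * m
    obtain ⟨z, hz⟩ := Infinite.exists_notMem_finset S
    refine ⟨z, fun s hs j hj h => hz ?_⟩
    simp only [S, Finset.mem_biUnion, Finset.mem_image, Finset.mem_range]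
    exact ⟨s, hs, j, hj, h.symm⟩
  have hmem : ∀ t, ∀ s, s < t → ∀ j < w s, p t ≠ p s + j * m := by
    intro t
    have := Nat.sInf_mem (hne t)
    rw [← hdef t] at this
    exact this
  have hmono : StrictMono p := by
    apply strictMono_nat_of_lt_succ
    intro t
    have h1 : p t ≤ p (t + 1) := by
      conv_lhs => rw [hdef t]
      exact Nat.sInf_le fun s hs j hj => hmem (t + 1) s (by omega) j hj
    have h2 := hmem (t + 1) t (by omega) 0 (hw t)
    simp at h2
    omega
  have huniq : ∀ t t' j j', t < t' → j < w t → j' < w t' → p t + j * m = p t' + j' * m → False := by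
    intro t t' j j' htt hj hj' h
    have h1 := hmono htt
    have h2 : j' < j := by
      by_contra hc
      push Not at hc
      have := Nat.mul_le_mul_right m hc
      omega
    apply hmem t' t htt (j - j') (by omega)
    have : j * m = (j - j') * m + j' * m := by rw [← add_mul]; congr 1; omega
    omega
  refine ⟨hmono, ?_, ?_⟩
  · intro z
    by_contra hc
    push Not at hc
    have h1 : p (z + 1) ≤ z := by
      rw [hdef]
      exact Nat.sInf_le fun s _ j hj => hc s j hj
    have := hmono.id_le (z + 1)
    simp at this
    omega
  · intro t t' j j' hj hj' h
    rcases lt_trichotomy t t' with h1 | h1 | h1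
    · exact (huniq t t' j j' h1 hj hj' h).elim
    · exact h1
    · exact (huniq t' t j' j h1 hj' hj h.symm).elim

lemma LinPart.le_aux {m : ℕ} {w p q : ℕ → ℕ} (hw : ∀ t, 1 ≤ w t) (hp : LinPart m w p)
    (hq : LinPart m w q) (t : ℕ) (ih : ∀ s < t, p s = q s) : q t ≤ p t := by
  obtain ⟨s, j, hj, h⟩ := hq.cover (p t)
  rcases lt_or_ge s t with hs | hs
  · rw [← ih s hs] at h
    have := hp.uniq t s 0 j (hw t) hj (by simpa using h)
    omega
  · have := hq.mono.monotone hs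
    omega

lemma LinPart.unique {m : ℕ} {w p q : ℕ → ℕ} (hw : ∀ t, 1 ≤ w t) (hp : LinPart m w p)
    (hq : LinPart m w q) : p = q := by
  funext t
  induction t using Nat.strong_induction_on with
  | _ t ih =>
    exact le_antisymm (hq.le_aux hw hp t fun s hs => (ih s hs).symm) (hp.le_aux hw hq t ih)

/-- At most `(m-1) L` heads fit in the gaps of a block. -/
lemma arc_lt {m : ℕ} (hm : 1 ≤ m) {p : ℕ → ℕ} (hp : StrictMono p) {s T L : ℕ}
    (hne : ∀ u, s < u → u ≤ T → ∀ k ≤ L, p u ≠ p s + k * m)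
    (hlt : s + (m - 1) * L < T) : p s + L * m < p T := by
  by_contra hc
  push Not at hc
  have h1 : (Finset.Ioc s T).image p ∪ (Finset.Ioc 0 L).image (fun k => p s + k * m) ⊆
      Finset.Ioc (p s) (p s + L * m) := by
    intro z hz
    simp only [Finset.mem_union, Finset.mem_image, Finset.mem_Ioc] at hz ⊢
    rcases hz with ⟨u, ⟨hu1, hu2⟩, rfl⟩ | ⟨u, ⟨hu1, hu2⟩, rfl⟩
    · have := hp hu1
      have := hp.monotone hu2
      omega
    · have := Nat.mul_le_mul_right m hu2
      have : 0 < u * m := Nat.mul_pos hu1 hm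
      omega
  have hd : Disjoint ((Finset.Ioc s T).image p)
      ((Finset.Ioc 0 L).image (fun k => p s + k * m)) := by
    rw [Finset.disjoint_left]
    intro z hz hz'
    simp only [Finset.mem_image, Finset.mem_Ioc] at hz hz'
    obtain ⟨u, ⟨hu1, hu2⟩, rfl⟩ := hz
    obtain ⟨k, ⟨hk1, hk2⟩, h⟩ := hz'
    exact hne u hu1 hu2 k hk2 h.symm
  have h2 := Finset.card_le_card h1
  rw [Finset.card_union_of_disjoint hd, Finset.card_image_of_injective _ hp.injective,
    Finset.card_image_of_injective] at h2
  · simp only [Nat.card_Ioc] at h2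
    have : L * m = (m - 1) * L + L := by
      obtain ⟨a, rfl⟩ := Nat.exists_eq_add_of_le hm
      simp
      ring
    omega
  · intro a b hab
    have : a * m = b * m := by simpa using hab
    exact Nat.eq_of_mul_eq_mul_right hm this

lemma LinPart.cut_lt {m : ℕ} (hm : 1 ≤ m) {w p : ℕ → ℕ} (hw : ∀ t, 1 ≤ w t)
    (hp : LinPart m w p) {T : ℕ} (hT : ∀ s < T, s + (m - 1) * (w s - 1) < T) :
    ∀ s < T, ∀ j < w s, p s + j * m < p T := by
  intro s hs j hj
  have h := arc_lt hm hp.mono (s := s) (T := T) (L := w s - 1) (fun u hu _ k hk h => by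
    have := hp.uniq u s 0 k (hw u) (by have := hw s; omega) (by simpa using h)
    omega) (hT s hs)
  have : j * m ≤ (w s - 1) * m := Nat.mul_le_mul_right m (by omega)
  omega

lemma LinPart.cut_sum {m : ℕ} (hm : 1 ≤ m) {w p : ℕ → ℕ} (hw : ∀ t, 1 ≤ w t)
    (hp : LinPart m w p) {T : ℕ} (hT : ∀ s < T, s + (m - 1) * (w s - 1) < T) :
    p T = ∑ s ∈ Finset.range T, w s := by
  classical
  have hcut := hp.cut_lt hm hw hT
  have : Finset.range (p T) = (Finset.range T).biUnion fun s =>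
      (Finset.range (w s)).image fun j => p s + j * m := by
    ext z
    simp only [Finset.mem_range, Finset.mem_biUnion, Finset.mem_image]
    constructor
    · intro hz
      obtain ⟨s, j, hj, h⟩ := hp.cover z
      refine ⟨s, ?_, j, hj, h.symm⟩
      by_contra hc
      have := hp.mono.monotone (not_lt.mp hc)
      omega
    · rintro ⟨s, hs, j, hj, rfl⟩
      exact hcut s hs j hj
  have h2 := congrArg Finset.card this
  rw [Finset.card_range, Finset.card_biUnion] at h2
  · rw [h2]
    refine Finset.sum_congr rfl fun s _ => ?_
    rw [Finset.card_image_of_injective, Finset.card_range]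
    intro a b hab
    have : a * m = b * m := by simpa using hab
    exact Nat.eq_of_mul_eq_mul_right hm this
  · intro s _ s' _ hss
    show Disjoint _ _
    rw [Finset.disjoint_left]
    intro z hz hz'
    simp only [Finset.mem_image, Finset.mem_range] at hz hz'
    obtain ⟨j, hj, rfl⟩ := hz
    obtain ⟨j', hj', h⟩ := hz'
    exact hss (hp.uniq s s' j j' hj hj' h.symm)

lemma LinPart.cut_shift {m : ℕ} (hm : 1 ≤ m) {w p : ℕ → ℕ} (hw : ∀ t, 1 ≤ w t)
    (hp : LinPart m w p) {T : ℕ} (hT : ∀ s < T, s + (m - 1) * (w s - 1) < T) :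
    LinPart m (fun t => w (T + t)) (fun t => p (T + t) - p T) := by
  have hcut := hp.cut_lt hm hw hT
  have hle : ∀ t, p T ≤ p (T + t) := fun t => hp.mono.monotone (by omega)
  refine ⟨?_, ?_, ?_⟩
  · intro a b hab
    have := hp.mono (show T + a < T + b by omega)
    have := hle a
    show p (T + a) - p T < p (T + b) - p T
    omega
  · intro z
    obtain ⟨t, j, hj, h⟩ := hp.cover (p T + z)
    have ht : T ≤ t := by
      by_contra hc
      have := hcut t (by omega) j hj
      omega
    obtain ⟨u, rfl⟩ := Nat.exists_eq_add_of_le ht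
    refine ⟨u, j, hj, ?_⟩
    have := hle u
    show z = p (T + u) - p T + j * m
    omega
  · intro t t' j j' hj hj' h
    have := hle t
    have := hle t'
    have := hp.uniq (T + t) (T + t') j j' hj hj' (by omega)
    omega

/-- Good cuts exist beyond every bound. -/
lemma exists_good_cut {N : ℕ} {c : ℕ → ℕ} (hper : ∀ t, c (t + N) = c t)
    (hsum : ∑ t ∈ Finset.range N, c t < N) (B : ℕ) :
    ∃ T, B ≤ T ∧ ∀ s < T, s + c s < T := by
  classical
  by_contra hc
  push Not at hc
  have hL : ∀ L, ∑ t ∈ Finset.range (L * N), c t = L * ∑ t ∈ Finset.range N, c t := by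
    intro L
    have hper' : ∀ L t, c (L * N + t) = c t := by
      intro L
      induction L with
      | zero => simp
      | succ L ih =>
        intro t
        rw [show (L + 1) * N + t = (L * N + t) + N by ring, hper, ih]
    induction L with
    | zero => simp
    | succ L ih =>
      rw [show (L + 1) * N = L * N + N by ring, Finset.sum_range_add, ih]
      simp only [hper']
      ring
  have hsub : Finset.Ico B ((B + 1) * N) ⊆
      (Finset.range ((B + 1) * N)).biUnion fun s => Finset.Ioc s (s + c s) := by
    intro T hT
    simp only [Finset.mem_Ico, Finset.mem_biUnion, Finset.mem_range, Finset.mem_Ioc] at hT ⊢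
    obtain ⟨s, hs, h⟩ := hc T hT.1
    exact ⟨s, by omega, hs, h⟩
  have h1 := (Finset.card_le_card hsub).trans Finset.card_biUnion_le
  simp only [Nat.card_Ico, Nat.card_Ioc, Nat.add_sub_cancel_left] at h1
  rw [hL] at h1
  have h2 : (B + 1) * (∑ t ∈ Finset.range N, c t + 1) ≤ (B + 1) * N := Nat.mul_le_mul_left _ hsum
  rw [mul_add] at h2
  omega

/-- Sums over objects of a given type. -/
lemma sum_of_type {α : Type*} (s : Finset α) (f : α → ℕ) (r : ℕ) (i k : ℕ → ℕ)
    (hinj : ∀ a b, 1 ≤ a → a ≤ r → 1 ≤ b → b ≤ r → i a = i b → a = b)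
    (hmem : ∀ a ∈ s, ∃ j, 1 ≤ j ∧ j ≤ r ∧ f a = i j)
    (hcnt : ∀ j, 1 ≤ j → j ≤ r → (s.filter fun a => f a = i j).card = k j) (g : ℕ → ℕ) :
    ∑ a ∈ s, g (f a) = ∑ j ∈ Finset.Icc 1 r, k j * g (i j) := by
  classical
  have h1 : ∀ a ∈ s, g (f a) = ∑ j ∈ Finset.Icc 1 r, if f a = i j then g (i j) else 0 := by
    intro a ha
    obtain ⟨j, hj1, hj2, hj⟩ := hmem a ha
    rw [Finset.sum_eq_single j]
    · simp [hj]
    · intro b hb hbj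
      rw [Finset.mem_Icc] at hb
      rw [if_neg]
      intro h
      exact hbj (hinj b j hb.1 hb.2 hj1 hj2 (h ▸ hj))
    · intro h
      exact (h (Finset.mem_Icc.mpr ⟨hj1, hj2⟩)).elim
  rw [Finset.sum_congr rfl h1, Finset.sum_comm]
  refine Finset.sum_congr rfl fun j hj => ?_
  rw [Finset.mem_Icc] at hj
  rw [← Finset.sum_filter, Finset.sum_const, hcnt j hj.1 hj.2, smul_eq_mul]

/-- Periodic words of the given type with a good cut at `0`. -/
structure GoodWord (N M r : ℕ) (i k w : ℕ → ℕ) : Prop where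
  per : ∀ t, w (t + N) = w t
  mem : ∀ t, ∃ j, 1 ≤ j ∧ j ≤ r ∧ w t = i j
  cnt : ∀ j, 1 ≤ j → j ≤ r → ((Finset.range N).filter fun t => w t = i j).card = k j
  good : ∀ t < N, t + (M - 1) * (w t - 1) < N

/-- The block number `t` of the partition attached to `(x, w)`. -/
noncomputable def wordBlock (n m : ℕ) (x : ZMod n) (w : ℕ → ℕ) (t : ℕ) : ZMod n × ℕ :=
  (x + (greedyHead m w t : ZMod n), w t)

noncomputable def wordPart (n N m : ℕ) (x : ZMod n) (w : ℕ → ℕ) : Finset (ZMod n × ℕ) :=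
  (Finset.range N).image (wordBlock n m x w)

/-- Standing numerical assumptions. -/
structure Setup (n N M r : ℕ) (i k : ℕ → ℕ) : Prop where
  npos : 0 < n
  Npos : 0 < N
  ipos : ∀ j, 1 ≤ j → j ≤ r → 1 ≤ i j
  inj : ∀ a b, 1 ≤ a → a ≤ r → 1 ≤ b → b ≤ r → i a = i b → a = b
  hN : ∑ j ∈ Finset.Icc 1 r, k j = N
  hn : ∑ j ∈ Finset.Icc 1 r, k j * i j = n
  hc : ∑ j ∈ Finset.Icc 1 r, k j * ((M - 1) * (i j - 1)) < N

section
variable {n N M r m : ℕ} {i k : ℕ → ℕ}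

lemma GoodWord.pos (S : Setup n N M r i k) {w : ℕ → ℕ} (h : GoodWord N M r i k w) :
    ∀ t, 1 ≤ w t := by
  intro t
  obtain ⟨j, h1, h2, h3⟩ := h.mem t
  rw [h3]
  exact S.ipos j h1 h2

lemma GoodWord.sum (S : Setup n N M r i k) {w : ℕ → ℕ} (h : GoodWord N M r i k w) :
    ∑ t ∈ Finset.range N, w t = n := by
  have := sum_of_type (Finset.range N) w r i k S.inj (fun a _ => h.mem a) h.cnt id
  simpa [S.hn] using this

lemma GoodWord.good_le (hmM : m ≤ M) {w : ℕ → ℕ} (h : GoodWord N M r i k w) :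
    ∀ t < N, t + (m - 1) * (w t - 1) < N := by
  intro t ht
  have h1 := h.good t ht
  have h2 : (m - 1) * (w t - 1) ≤ (M - 1) * (w t - 1) := Nat.mul_le_mul_right _ (by omega)
  omega

lemma GoodWord.head_add (S : Setup n N M r i k) (hm : 1 ≤ m) (hmM : m ≤ M) {w : ℕ → ℕ}
    (h : GoodWord N M r i k w) (t : ℕ) :
    greedyHead m w (t + N) = greedyHead m w t + n := by
  have hw := h.pos S
  have hL := linPart_greedyHead m w hw
  have hg := h.good_le hmM
  have h1 := hL.cut_sum hm hw hg
  rw [h.sum S] at h1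
  have h2 := hL.cut_shift hm hw hg
  have h3 : (fun t => w (N + t)) = w := by
    funext t
    rw [add_comm, h.per]
  rw [h3] at h2
  have h4 := congrFun (hL.unique hw h2) t
  rw [h1] at h4
  have h5 := hL.mono.monotone (show N ≤ N + t by omega)
  rw [h1] at h5
  rw [add_comm t N]
  omega

lemma GoodWord.head_add_mul (S : Setup n N M r i k) (hm : 1 ≤ m) (hmM : m ≤ M) {w : ℕ → ℕ}
    (h : GoodWord N M r i k w) (t a : ℕ) :
    greedyHead m w (t + a * N) = greedyHead m w t + a * n := by
  induction a with
  | zero => simp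
  | succ a ih =>
    rw [show t + (a + 1) * N = t + a * N + N by ring, h.head_add S hm hmM, ih]
    ring

lemma GoodWord.per_mul {w : ℕ → ℕ}
    (h : GoodWord N M r i k w) (t a : ℕ) : w (t + a * N) = w t := by
  induction a with
  | zero => simp
  | succ a ih =>
    rw [show t + (a + 1) * N = t + a * N + N by ring, h.per, ih]

lemma GoodWord.block_periodic (S : Setup n N M r i k) (hm : 1 ≤ m) (hmM : m ≤ M) {w : ℕ → ℕ}
    (h : GoodWord N M r i k w) (x : ZMod n) : Function.Periodic (wordBlock n m x w) N := by
  intro t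
  simp [wordBlock, h.per, h.head_add S hm hmM]

lemma GoodWord.mem_part (S : Setup n N M r i k) (hm : 1 ≤ m) (hmM : m ≤ M) {w : ℕ → ℕ}
    (h : GoodWord N M r i k w) (x : ZMod n) (b : ZMod n × ℕ) :
    b ∈ wordPart n N m x w ↔ ∃ t, wordBlock n m x w t = b := by
  simp only [wordPart, Finset.mem_image, Finset.mem_range]
  constructor
  · rintro ⟨t, _, ht⟩
    exact ⟨t, ht⟩
  · rintro ⟨t, ht⟩
    refine ⟨t % N, Nat.mod_lt _ S.Npos, ?_⟩
    rw [(h.block_periodic S hm hmM x).map_mod_nat, ht]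

lemma exists_add_mul_eq {n a b : ℕ} (h : (a : ZMod n) = b) : ∃ u v : ℕ, a + u * n = b + v * n := by
  rw [ZMod.natCast_eq_natCast_iff'] at h
  refine ⟨b / n, a / n, ?_⟩
  have h1 := Nat.mod_add_div a n
  have h2 := Nat.mod_add_div b n
  rw [h] at h1
  rw [mul_comm] at h1 h2
  omega

lemma GoodWord.uniq (S : Setup n N M r i k) (hm : 1 ≤ m) (hmM : m ≤ M) {w : ℕ → ℕ}
    (h : GoodWord N M r i k w) (x : ZMod n) {t t' j j' : ℕ} (ht : t < N) (ht' : t' < N)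
    (hj : j < w t) (hj' : j' < w t')
    (he : x + (greedyHead m w t : ZMod n) + ((j * m : ℕ) : ZMod n)
      = x + (greedyHead m w t' : ZMod n) + ((j' * m : ℕ) : ZMod n)) : t = t' := by
  rw [add_assoc, add_assoc, add_right_inj] at he
  norm_cast at he
  obtain ⟨u, v, huv⟩ := exists_add_mul_eq he
  have hL := linPart_greedyHead m w (h.pos S)
  have := hL.uniq (t + u * N) (t' + v * N) j j' (by rwa [h.per_mul]) (by rwa [h.per_mul]) (by
    rw [h.head_add_mul S hm hmM, h.head_add_mul S hm hmM]
    omega)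
  have h2 := congrArg (· % N) this
  simpa [Nat.mod_eq_of_lt ht, Nat.mod_eq_of_lt ht'] using h2

lemma GoodWord.isAPPartition (S : Setup n N M r i k) (hm : 1 ≤ m) (hmM : m ≤ M) {w : ℕ → ℕ}
    (h : GoodWord N M r i k w) (x : ZMod n) : IsAPPartition n m (wordPart n N m x w) := by
  have hL := linPart_greedyHead m w (h.pos S)
  refine ⟨?_, ?_, ?_⟩
  · intro b hb
    obtain ⟨t, rfl⟩ := (h.mem_part S hm hmM x b).1 hb
    exact h.pos S t
  · intro b hb b' hb' hne
    simp only [wordPart, Finset.mem_image, Finset.mem_range] at hb hb'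
    obtain ⟨t, ht, rfl⟩ := hb
    obtain ⟨t', ht', rfl⟩ := hb'
    rw [Finset.disjoint_left]
    intro z hz hz'
    simp only [blockSet, wordBlock, Finset.mem_image, Finset.mem_range] at hz hz'
    obtain ⟨j, hj, rfl⟩ := hz
    obtain ⟨j', hj', he⟩ := hz'
    exact hne (by rw [h.uniq S hm hmM x ht ht' hj hj' he.symm])
  · intro z
    have : NeZero n := ⟨S.npos.ne'⟩
    obtain ⟨t, j, hj, he⟩ := hL.cover (z - x).val
    refine ⟨wordBlock n m x w t, (h.mem_part S hm hmM x _).2 ⟨t, rfl⟩, ?_⟩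
    simp only [blockSet, wordBlock, Finset.mem_image, Finset.mem_range]
    refine ⟨j, hj, ?_⟩
    rw [add_assoc, ← Nat.cast_add, ← he]
    simp

lemma GoodWord.hasType (S : Setup n N M r i k) (hm : 1 ≤ m) (hmM : m ≤ M) {w : ℕ → ℕ}
    (h : GoodWord N M r i k w) (x : ZMod n) : HasType n (wordPart n N m x w) r i k := by
  refine ⟨?_, ?_⟩
  · intro b hb
    obtain ⟨t, rfl⟩ := (h.mem_part S hm hmM x b).1 hb
    exact h.mem t
  · intro j hj1 hj2
    rw [wordPart, Finset.filter_image, Finset.card_image_of_injOn]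
    · exact h.cnt j hj1 hj2
    · intro t ht t' ht' he
      simp only [Finset.coe_filter, Finset.mem_range, Set.mem_ofPred_eq] at ht ht'
      simp only [wordBlock, Prod.mk.injEq] at he
      exact h.uniq S hm hmM x ht.1 ht'.1 (h.pos S t) (h.pos S t') (by rw [he.1])

/-- Moving the good cut. -/
def WordRel {n : ℕ} (x : ZMod n) (w : ℕ → ℕ) (x' : ZMod n) (w' : ℕ → ℕ) (N : ℕ) : Prop :=
  ∃ t < N, (∀ u, w' u = w (t + u)) ∧ x' = x + ((∑ s ∈ Finset.range t, w s : ℕ) : ZMod n)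

lemma GoodWord.cut_of_shift (hmM : m ≤ M) {w w' : ℕ → ℕ}
    (h : GoodWord N M r i k w) (h' : GoodWord N M r i k w') {t : ℕ} (ht : t < N)
    (hs : ∀ u, w' u = w (t + u)) : ∀ s < t, s + (m - 1) * (w s - 1) < t := by
  intro s hst
  have h1 := h'.good_le hmM (N - t + s) (by omega)
  rw [hs, show t + (N - t + s) = s + N by omega, h.per] at h1
  omega

lemma GoodWord.rel_imp (S : Setup n N M r i k) (hm : 1 ≤ m) (hmM : m ≤ M) {w w' : ℕ → ℕ}
    (h : GoodWord N M r i k w) (h' : GoodWord N M r i k w') {x x' : ZMod n}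
    (hR : WordRel x w x' w' N) : wordPart n N m x w = wordPart n N m x' w' := by
  obtain ⟨t, ht, hs, hx⟩ := hR
  have hcut := h.cut_of_shift hmM h' ht hs
  have hw := h.pos S
  have hL := linPart_greedyHead m w hw
  have h1 := hL.cut_sum hm hw hcut
  have h2 := hL.cut_shift hm hw hcut
  rw [← funext hs] at h2
  have h3 := h2.unique (h'.pos S) (linPart_greedyHead m w' (h'.pos S))
  have h4 : ∀ u, greedyHead m w (t + u) = greedyHead m w t + greedyHead m w' u := by
    intro u
    have h6 : greedyHead m w (t + u) - greedyHead m w t = greedyHead m w' u := congrFun h3 u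
    have := hL.mono.monotone (show t ≤ t + u by omega)
    omega
  have h5 : ∀ u, wordBlock n m x' w' u = wordBlock n m x w (t + u) := by
    intro u
    simp only [wordBlock, hs, h4, hx, ← h1]
    push_cast
    rw [add_assoc]
  ext b
  rw [h.mem_part S hm hmM, h'.mem_part S hm hmM]
  constructor
  · rintro ⟨u, rfl⟩
    refine ⟨u + (N - t), ?_⟩
    rw [h5, show t + (u + (N - t)) = u + N by omega, h.block_periodic S hm hmM x]
  · rintro ⟨u, rfl⟩
    exact ⟨t + u, (h5 u).symm⟩

lemma GoodWord.rel_of_eq (S : Setup n N M r i k) (hm : 1 ≤ m) (hmM : m ≤ M) {w w' : ℕ → ℕ}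
    (h : GoodWord N M r i k w) (h' : GoodWord N M r i k w') {x x' : ZMod n}
    (he : wordPart n N m x w = wordPart n N m x' w') : WordRel x w x' w' N := by
  have hw := h.pos S
  have hw' := h'.pos S
  have hL := linPart_greedyHead m w hw
  have hL' := linPart_greedyHead m w' hw'
  have hP := h.isAPPartition S hm hmM x
  -- the head determines the block
  have hdet : ∀ t t', (wordBlock n m x w t).1 = (wordBlock n m x' w' t').1 →
      wordBlock n m x w t = wordBlock n m x' w' t' := by
    intro t t' ht
    by_contra hne
    have hd := hP.2.1 _ ((h.mem_part S hm hmM x _).2 ⟨t, rfl⟩) (wordBlock n m x' w' t')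
      (by rw [he]; exact (h'.mem_part S hm hmM x' _).2 ⟨t', rfl⟩) hne
    rw [Finset.disjoint_left] at hd
    refine hd (a := (wordBlock n m x w t).1) ?_ ?_
    · simp only [blockSet, Finset.mem_image, Finset.mem_range]
      exact ⟨0, hw t, by simp⟩
    · simp only [blockSet, Finset.mem_image, Finset.mem_range]
      exact ⟨0, hw' t', by simp [ht]⟩
  have h0' : greedyHead m w' 0 = 0 := by
    have := hL'.cut_sum hm hw' (T := 0) (by simp)
    simpa using this
  have hx' : wordBlock n m x' w' 0 ∈ wordPart n N m x w := by
    rw [he]; exact (h'.mem_part S hm hmM x' _).2 ⟨0, rfl⟩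
  simp only [wordPart, Finset.mem_image, Finset.mem_range] at hx'
  obtain ⟨t, ht, hbt⟩ := hx'
  have hx0 : x' = x + (greedyHead m w t : ZMod n) := by
    have := congrArg Prod.fst hbt
    simpa [wordBlock, h0'] using this.symm
  have key : (fun u => greedyHead m w (t + u)) = fun u => greedyHead m w t + greedyHead m w' u := by
    have m1 : StrictMono (fun u => greedyHead m w (t + u)) := fun a b hab => hL.mono (by omega)
    have m2 : StrictMono (fun u => greedyHead m w t + greedyHead m w' u) := fun a b hab => by
      have := hL'.mono hab
      show _ + _ < _ + _
      omega
    rw [← StrictMono.range_inj m1 m2]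
    ext z
    simp only [Set.mem_range]
    constructor
    · rintro ⟨u, rfl⟩
      have hu : wordBlock n m x w (t + u) ∈ wordPart n N m x' w' := by
        rw [← he]; exact (h.mem_part S hm hmM x _).2 ⟨_, rfl⟩
      obtain ⟨s, hs⟩ := (h'.mem_part S hm hmM x' _).1 hu
      have hs1 := congrArg Prod.fst hs
      simp only [wordBlock, hx0] at hs1
      rw [add_assoc, add_right_inj] at hs1
      norm_cast at hs1
      have hle := hL.mono.monotone (show t ≤ t + u by omega)
      obtain ⟨a, b, hab⟩ := exists_add_mul_eq hs1
      -- `p t + p' s + a n = p (t+u) + b n`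
      have hs2 := h'.head_add_mul S hm hmM s a
      obtain ⟨q, j, hj, hq⟩ := hL'.cover (greedyHead m w (t + u) - greedyHead m w t)
      have hq2 := hL'.uniq (s + a * N) (q + b * N) 0 j (hw' _) (by rwa [h'.per_mul]) (by
        rw [h'.head_add_mul S hm hmM, h'.head_add_mul S hm hmM]
        omega)
      have hq3 := congrArg (greedyHead m w') hq2
      rw [h'.head_add_mul S hm hmM, h'.head_add_mul S hm hmM] at hq3
      exact ⟨q, by omega⟩
    · rintro ⟨u, rfl⟩
      have hu : wordBlock n m x' w' u ∈ wordPart n N m x w := by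
        rw [he]; exact (h'.mem_part S hm hmM x' _).2 ⟨_, rfl⟩
      obtain ⟨s, hs⟩ := (h.mem_part S hm hmM x _).1 hu
      have hs1 := congrArg Prod.fst hs
      simp only [wordBlock, hx0] at hs1
      rw [add_assoc, add_right_inj] at hs1
      norm_cast at hs1
      obtain ⟨a, b, hab⟩ := exists_add_mul_eq hs1
      obtain ⟨q, j, hj, hq⟩ := hL.cover (greedyHead m w t + greedyHead m w' u)
      have hq2 := hL.uniq (s + a * N) (q + b * N) 0 j (hw _) (by rwa [h.per_mul]) (by
        rw [h.head_add_mul S hm hmM, h.head_add_mul S hm hmM]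
        omega)
      have hq3 := congrArg (greedyHead m w) hq2
      rw [h.head_add_mul S hm hmM, h.head_add_mul S hm hmM] at hq3
      have hq4 : greedyHead m w q = greedyHead m w t + greedyHead m w' u := by omega
      have htq : t ≤ q := by
        rw [← hL.mono.le_iff_le]
        omega
      refine ⟨q - t, ?_⟩
      rw [show t + (q - t) = q by omega, hq4]
  have hs : ∀ u, w' u = w (t + u) := by
    intro u
    have := hdet (t + u) u (by
      have := congrFun key u
      simp only [wordBlock, this, hx0]
      push_cast
      rw [add_assoc])
    exact (congrArg Prod.snd this).symm
  refine ⟨t, ht, hs, ?_⟩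
  rw [hx0, hL.cut_sum hm hw (h.cut_of_shift hmM h' ht hs)]

lemma part_card (S : Setup n N M r i k) {π : Finset (ZMod n × ℕ)} (hT : HasType n π r i k) :
    π.card = N := by
  have := sum_of_type π Prod.snd r i k S.inj hT.1 hT.2 (fun _ => 1)
  simpa [S.hN] using this

/-- Elements of blocks are pairwise distinct, also inside a single block. -/
lemma part_inj (S : Setup n N M r i k) {π : Finset (ZMod n × ℕ)}
    (hP : IsAPPartition n m π) (hT : HasType n π r i k) {b b' : ZMod n × ℕ} (hb : b ∈ π)
    (hb' : b' ∈ π) {j j' : ℕ} (hj : j < b.2) (hj' : j' < b'.2)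
    (he : b.1 + ((j * m : ℕ) : ZMod n) = b'.1 + ((j' * m : ℕ) : ZMod n)) : b = b' ∧ j = j' := by
  classical
  have : NeZero n := ⟨S.npos.ne'⟩
  have hbb : b = b' := by
    by_contra hne
    have hd := hP.2.1 b hb b' hb' hne
    rw [Finset.disjoint_left] at hd
    refine hd (a := b.1 + ((j * m : ℕ) : ZMod n)) ?_ ?_
    · exact Finset.mem_image.2 ⟨j, Finset.mem_range.2 hj, rfl⟩
    · exact Finset.mem_image.2 ⟨j', Finset.mem_range.2 hj', he.symm⟩
  refine ⟨hbb, ?_⟩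
  subst hbb
  have hun : π.biUnion (blockSet n m) = Finset.univ := by
    ext z
    simpa using hP.2.2 z
  have h1 := congrArg Finset.card hun
  rw [Finset.card_biUnion (fun x hx y hy hxy => hP.2.1 x hx y hy hxy), Finset.card_univ,
    ZMod.card] at h1
  have h2 := sum_of_type π Prod.snd r i k S.inj hT.1 hT.2 id
  simp only [id, S.hn] at h2
  have hle : ∀ c ∈ π, (blockSet n m c).card ≤ c.2 := fun c _ =>
    Finset.card_image_le.trans (by simp)
  have h3 := (Finset.sum_eq_sum_iff_of_le hle).1 (h1.trans h2.symm) b hb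
  have h4 : Set.InjOn (fun j => b.1 + ((j * m : ℕ) : ZMod n)) (Finset.range b.2) := by
    rw [← Finset.card_image_iff]
    simpa [blockSet] using h3
  exact h4 (by simpa using hj) (by simpa using hj') he

lemma exists_word_s7 (S : Setup n N M r i k) (hm : 1 ≤ m) (hmM : m ≤ M) {π : Finset (ZMod n × ℕ)}
    (hP : IsAPPartition n m π) (hT : HasType n π r i k) :
    ∃ x w, GoodWord N M r i k w ∧ wordPart n N m x w = π := by
  classical
  have : NeZero n := ⟨S.npos.ne'⟩
  set H : Finset (ZMod n) := π.image Prod.fst with hH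
  have hfst : ∀ b ∈ π, ∀ b' ∈ π, b.1 = b'.1 → b = b' := fun b hb b' hb' he =>
    (part_inj S hP hT hb hb' (hP.1 b hb) (hP.1 b' hb') (by simp [he])).1
  have hHc : H.card = N := by
    rw [hH, Finset.card_image_of_injOn, part_card S hT]
    exact fun b hb b' hb' he => hfst b hb b' hb' he
  let P : ℕ → Prop := fun z => (z : ZMod n) ∈ H
  have hPper : ∀ z, P (n + z) ↔ P z := by
    intro z
    simp [P]
  have hcount : Nat.count P n = N := by
    rw [Nat.count_eq_card_filter_range, ← hHc]
    refine Finset.card_bij (fun z _ => (z : ZMod n)) ?_ ?_ ?_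
    · intro z hz
      exact (Finset.mem_filter.1 hz).2
    · intro a ha b hb hab
      rw [Finset.mem_filter, Finset.mem_range] at ha hb
      rw [ZMod.natCast_eq_natCast_iff'] at hab
      rwa [Nat.mod_eq_of_lt ha.1, Nat.mod_eq_of_lt hb.1] at hab
    · intro h hh
      refine ⟨h.val, ?_, by simp⟩
      rw [Finset.mem_filter, Finset.mem_range]
      exact ⟨ZMod.val_lt h, by simpa [P] using hh⟩
  have hcount2 : ∀ z, Nat.count P (n + z) = N + Nat.count P z := by
    intro z
    rw [Nat.count_add, hcount]
    simp only [hPper]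
  have hinf : (Set.ofPred P).Infinite := by
    have hNp := S.Npos
    have hbig : ∀ a, a ≤ Nat.count P (a * n) := by
      intro a
      induction a with
      | zero => simp
      | succ a ih =>
        rw [show (a + 1) * n = n + a * n by ring, hcount2]
        omega
    intro hfin
    have h1 := hbig (hfin.toFinset.card + 1)
    rw [Nat.count_eq_card_filter_range] at h1
    have h2 : ({x ∈ Finset.range ((hfin.toFinset.card + 1) * n) | P x}).card ≤
        hfin.toFinset.card := by
      apply Finset.card_le_card
      intro z hz
      exact hfin.mem_toFinset.2 (Finset.mem_filter.1 hz).2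
    omega
  let e : ℕ → ℕ := Nat.nth P
  have hemono : StrictMono e := Nat.nth_strictMono hinf
  have heP : ∀ t, P (e t) := fun t => Nat.nth_mem_of_infinite hinf t
  have heper : ∀ t, e (t + N) = e t + n := by
    intro t
    have h1 : Nat.count P (n + e t) = t + N := by
      rw [hcount2, Nat.count_nth_of_infinite hinf]
      omega
    rw [← h1]
    show Nat.nth P (Nat.count P (n + e t)) = _
    rw [Nat.nth_count ((hPper _).2 (heP t)), add_comm]
  have hesurj : ∀ z, P z → ∃ t, e t = z := fun z hz => ⟨Nat.count P z, Nat.nth_count hz⟩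
  have hlen : ∀ h : ZMod n, ∃ l, h ∈ H → (h, l) ∈ π := by
    intro h
    by_cases hh : h ∈ H
    · obtain ⟨b, hb, rfl⟩ := Finset.mem_image.1 hh
      exact ⟨b.2, fun _ => hb⟩
    · exact ⟨0, fun h => (hh h).elim⟩
  choose len hlen using hlen
  let v : ℕ → ℕ := fun t => len (e t)
  have hv : ∀ t, (((e t : ℕ) : ZMod n), v t) ∈ π := fun t => hlen _ (heP t)
  have hvper : ∀ t, v (t + N) = v t := by
    intro t
    simp [v, heper]
  -- distinctness in the lift
  have hlift : ∀ s s' j j', j < v s → j' < v s' → e s + j * m = e s' + j' * m → s = s' := by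
    intro s s' j j' hj hj' h
    have h1 := part_inj S hP hT (hv s) (hv s') hj hj' (by
      show ((e s : ℕ) : ZMod n) + _ = ((e s' : ℕ) : ZMod n) + _
      rw [← Nat.cast_add, h, Nat.cast_add])
    rw [h1.2] at h
    exact hemono.injective (by omega)
  have hvpos : ∀ t, 1 ≤ v t := fun t => hP.1 _ (hv t)
  -- every window of length `N` enumerates `π`
  let β : ℕ → ℕ → ZMod n × ℕ := fun T t => (((e (T + t) : ℕ) : ZMod n), v (T + t))
  have hβinj : ∀ T, Set.InjOn (β T) (Finset.range N) := by
    intro T t ht t' ht' he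
    simp only [Finset.coe_range, Set.mem_Iio] at ht ht'
    have h1 : ((e (T + t) : ℕ) : ZMod n) = ((e (T + t') : ℕ) : ZMod n) := congrArg Prod.fst he
    wlog hle : t ≤ t' generalizing t t'
    · exact (this he.symm ht' ht h1.symm (by omega)).symm
    have h2 := hemono.monotone (show T + t ≤ T + t' by omega)
    have h3 := hemono (show T + t' < T + t + N by omega)
    rw [heper] at h3
    rw [ZMod.natCast_eq_natCast_iff] at h1
    have h4 := (Nat.modEq_iff_dvd' h2).1 h1
    have h5 := Nat.eq_zero_of_dvd_of_lt h4 (by omega)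
    have := hemono.injective (show e (T + t) = e (T + t') by omega)
    omega
  have hβim : ∀ T, (Finset.range N).image (β T) = π := by
    intro T
    apply Finset.eq_of_subset_of_card_le
    · intro b hb
      obtain ⟨t, _, rfl⟩ := Finset.mem_image.1 hb
      exact hv _
    · rw [Finset.card_image_of_injOn (hβinj T), part_card S hT, Finset.card_range]
  have hcnt : ∀ T j, 1 ≤ j → j ≤ r →
      ((Finset.range N).filter fun t => v (T + t) = i j).card = k j := by
    intro T j h1 h2
    rw [← hT.2 j h1 h2, ← hβim T, Finset.filter_image, Finset.card_image_of_injOn]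
    exact (hβinj T).mono (by intro t; simp +contextual)
  have hmem : ∀ t, ∃ j, 1 ≤ j ∧ j ≤ r ∧ v t = i j := fun t => hT.1 _ (hv t)
  have hsum : ∑ t ∈ Finset.range N, (M - 1) * (v t - 1) < N := by
    have := sum_of_type (Finset.range N) v r i k S.inj (fun a _ => hmem a)
      (by simpa using hcnt 0) (fun a => (M - 1) * (a - 1))
    rw [this]
    exact S.hc
  obtain ⟨T, hTB, hTg⟩ := exists_good_cut (c := fun t => (M - 1) * (v t - 1))
    (fun t => by simp only [hvper]) hsum (N + (n + 1) * m + n * m)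
  let w : ℕ → ℕ := fun t => v (T + t)
  have hgw : GoodWord N M r i k w := by
    refine ⟨fun t => ?_, fun t => hmem _, hcnt T, ?_⟩
    · show v (T + (t + N)) = v (T + t)
      rw [← add_assoc, hvper]
    · intro t ht
      have h1 := hTg (T + t - N) (by omega)
      have h2 : v (T + t) = v (T + t - N) := by
        rw [← hvper (T + t - N)]
        congr 1
        omega
      show t + (M - 1) * (v (T + t) - 1) < N
      rw [h2]
      omega
  have hvle : ∀ t, v t ≤ n := by
    intro t
    have h2 := sum_of_type π Prod.snd r i k S.inj hT.1 hT.2 id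
    simp only [id, S.hn] at h2
    rw [← h2]
    exact Finset.single_le_sum (f := fun b : ZMod n × ℕ => b.2) (fun _ _ => Nat.zero_le _) (hv t)
  -- blocks before the cut end before the cut
  have hcut : ∀ s < T, ∀ j < v s, e s + j * m < e T := by
    intro s hs j hj
    have h1 : (m - 1) * (v s - 1) ≤ (M - 1) * (v s - 1) := Nat.mul_le_mul_right _ (by omega)
    have h2 := hTg s hs
    have h := arc_lt hm hemono (s := s) (T := T) (L := v s - 1) (fun u hu _ l hl h => by
      have := hlift u s 0 l (hvpos u) (by have := hvpos s; omega) (by simpa using h)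
      omega) (by omega)
    have : j * m ≤ (v s - 1) * m := Nat.mul_le_mul_right m (by omega)
    omega
  have hle : ∀ t, e T ≤ e (T + t) := fun t => hemono.monotone (by omega)
  have hLin : LinPart m w (fun t => e (T + t) - e T) := by
    refine ⟨?_, ?_, ?_⟩
    · intro a b hab
      have := hemono (show T + a < T + b by omega)
      have := hle a
      show e (T + a) - e T < e (T + b) - e T
      omega
    · intro z
      obtain ⟨b, hb, hz⟩ := hP.2.2 (((e T + z : ℕ)) : ZMod n)
      obtain ⟨j, hj, hz⟩ := Finset.mem_image.1 hz
      rw [Finset.mem_range] at hj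
      -- bound on `j * m`
      have hjm : j * m ≤ e T + z := by
        have h1 : b.2 ≤ n := by
          have hbm := hb
          rw [← hβim 0] at hbm
          obtain ⟨t, _, rfl⟩ := Finset.mem_image.1 hbm
          exact hvle _
        have h2 : j * m ≤ n * m := Nat.mul_le_mul_right m (by omega)
        have h3 : T ≤ e T := hemono.id_le T
        omega
      have hcast : ((e T + z - j * m : ℕ) : ZMod n) = b.1 := by
        rw [Nat.cast_sub hjm, ← hz]
        simp
      obtain ⟨s, hs⟩ := hesurj (e T + z - j * m) (by
        show ((e T + z - j * m : ℕ) : ZMod n) ∈ H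
        rw [hcast]
        exact Finset.mem_image_of_mem _ hb)
      have hbs : (((e s : ℕ) : ZMod n), v s) = b := hfst _ (hv s) _ hb (by
        show ((e s : ℕ) : ZMod n) = b.1
        rw [hs, hcast])
      have hjs : j < v s := by rw [← hbs] at hj; exact hj
      have hTs : T ≤ s := by
        by_contra hc
        have := hcut s (by omega) j hjs
        omega
      obtain ⟨u, rfl⟩ := Nat.exists_eq_add_of_le hTs
      refine ⟨u, j, hjs, ?_⟩
      have := hle u
      show z = e (T + u) - e T + j * m
      omega
    · intro t t' j j' hj hj' h
      have := hle t
      have := hle t'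
      have := hlift (T + t) (T + t') j j' hj hj' (by omega)
      omega
  refine ⟨(e T : ZMod n), w, hgw, ?_⟩
  rw [← hβim T, wordPart]
  refine Finset.image_congr fun t _ => ?_
  have h1 := (linPart_greedyHead m w (hgw.pos S)).unique (hgw.pos S) hLin
  show (_, _) = (_, _)
  rw [h1]
  simp only [Prod.mk.injEq]
  refine ⟨?_, rfl⟩
  rw [← Nat.cast_add]
  congr 1
  have := hle t
  omega

end

/-- The parametrization of the `m`-AP-partitions by good words. -/
noncomputable def paramMap {n N M r : ℕ} {i k : ℕ → ℕ} (S : Setup n N M r i k) {m : ℕ}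
    (hm : 1 ≤ m) (hmM : m ≤ M) (a : ZMod n × {w // GoodWord N M r i k w}) :
    {π : Finset (ZMod n × ℕ) // IsAPPartition n m π ∧ HasType n π r i k} :=
  ⟨wordPart n N m a.1 a.2.1, a.2.2.isAPPartition S hm hmM a.1, a.2.2.hasType S hm hmM a.1⟩

lemma paramMap_eq_iff {n N M r : ℕ} {i k : ℕ → ℕ} (S : Setup n N M r i k) {m : ℕ}
    (hm : 1 ≤ m) (hmM : m ≤ M) (a b : ZMod n × {w // GoodWord N M r i k w}) :
    paramMap S hm hmM a = paramMap S hm hmM b ↔ WordRel a.1 a.2.1 b.1 b.2.1 N := by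
  rw [paramMap, paramMap, Subtype.mk.injEq]
  exact ⟨fun h => a.2.2.rel_of_eq S hm hmM b.2.2 h, fun h => a.2.2.rel_imp S hm hmM b.2.2 h⟩

lemma paramMap_surj {n N M r : ℕ} {i k : ℕ → ℕ} (S : Setup n N M r i k) {m : ℕ}
    (hm : 1 ≤ m) (hmM : m ≤ M) : Function.Surjective (paramMap S hm hmM) := by
  rintro ⟨π, hP, hT⟩
  obtain ⟨x, w, hw, h⟩ := exists_word_s7 S hm hmM hP hT
  exact ⟨(x, ⟨w, hw⟩), Subtype.ext h⟩

lemma nonempty_equiv {n N M r : ℕ} {i k : ℕ → ℕ} (S : Setup n N M r i k) {m m' : ℕ}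
    (hm : 1 ≤ m) (hmM : m ≤ M) (hm' : 1 ≤ m') (hmM' : m' ≤ M) :
    Nonempty
      ({π : Finset (ZMod n × ℕ) // IsAPPartition n m π ∧ HasType n π r i k} ≃
        {π : Finset (ZMod n × ℕ) // IsAPPartition n m' π ∧ HasType n π r i k}) := by
  have hker : Setoid.ker (paramMap S hm hmM) = Setoid.ker (paramMap S hm' hmM') := by
    ext a b
    rw [Setoid.ker_def, Setoid.ker_def, paramMap_eq_iff, paramMap_eq_iff]
  exact ⟨(Setoid.quotientKerEquivOfSurjective _ (paramMap_surj S hm hmM)).symm.trans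
    ((Quotient.congrRight fun a b => by
      show (Setoid.ker (paramMap S hm hmM)) a b ↔ (Setoid.ker (paramMap S hm' hmM')) a b
      rw [hker]).trans
    (Setoid.quotientKerEquivOfSurjective _ (paramMap_surj S hm' hmM')))⟩

lemma setup_of (M r : ℕ) (i k : ℕ → ℕ) (hr : 2 ≤ r)
    (hi1 : i 1 = 1)
    (hmono : ∀ j, 1 ≤ j → j < r → i j < i (j + 1))
    (hk : ∀ j, 1 ≤ j → j ≤ r → 1 ≤ k j)
    (n : ℕ) (hn : n = k 1 + ∑ j ∈ Finset.Icc 2 r, k j * i j)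
    (hcond : (((M - 1) * (i r - 1) : ℕ) : ℤ) ≤
      ⌈(k 1 : ℚ) / ((∑ j ∈ Finset.Icc 2 r, k j : ℕ) : ℚ)⌉) :
    Setup n (∑ j ∈ Finset.Icc 1 r, k j) M r i k := by
  have hsplit : ∀ f : ℕ → ℕ, ∑ j ∈ Finset.Icc 1 r, f j = f 1 + ∑ j ∈ Finset.Icc 2 r, f j := by
    intro f
    rw [← Finset.add_sum_Ioc_eq_sum_Icc (by omega : 1 ≤ r)]
    rfl
  have hlt : ∀ a b, 1 ≤ a → a < b → b ≤ r → i a < i b := by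
    intro a b ha hab
    induction b, hab using Nat.le_induction with
    | base => exact fun h => hmono a ha (by omega)
    | succ b hb ih => exact fun h => (ih (by omega)).trans (hmono b (by omega) (by omega))
  have hk1 := hk 1 le_rfl (by omega)
  refine ⟨by omega, ?_, ?_, ?_, rfl, ?_, ?_⟩
  · rw [hsplit]
    omega
  · intro j h1 h2
    rcases Nat.eq_or_lt_of_le h1 with h | h
    · rw [← h, hi1]
    · have := hlt 1 j le_rfl h h2
      omega
  · intro a b ha har hb hbr hab
    rcases lt_trichotomy a b with h | h | h
    · have := hlt a b ha h hbr
      omega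
    · exact h
    · have := hlt b a hb h har
      omega
  · rw [hsplit, hi1, mul_one, hn]
  · rw [hsplit, hsplit, hi1]
    set K := ∑ j ∈ Finset.Icc 2 r, k j with hK
    have hKpos : 0 < K := by
      have h1 : k 2 ≤ K := Finset.single_le_sum (f := k) (fun _ _ => Nat.zero_le _)
        (Finset.mem_Icc.2 ⟨le_rfl, hr⟩)
      have := hk 2 (by omega) hr
      omega
    set A := (M - 1) * (i r - 1) with hA
    have h1 : ∑ j ∈ Finset.Icc 2 r, k j * ((M - 1) * (i j - 1)) ≤ K * A := by
      rw [hK, Finset.sum_mul]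
      refine Finset.sum_le_sum fun j hj => ?_
      rw [Finset.mem_Icc] at hj
      refine Nat.mul_le_mul_left _ (Nat.mul_le_mul_left _ ?_)
      rcases Nat.eq_or_lt_of_le hj.2 with h | h
      · rw [h]
      · have := hlt j r (by omega) h le_rfl
        omega
    have h2 : K * A < k 1 + K := by
      have hKQ : (0 : ℚ) < K := by exact_mod_cast hKpos
      have h3 : (A : ℚ) ≤ ((⌈(k 1 : ℚ) / (K : ℚ)⌉ : ℤ) : ℚ) := by exact_mod_cast hcond
      have h4 := Int.ceil_lt_add_one ((k 1 : ℚ) / (K : ℚ))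
      have h5 : (A : ℚ) < (k 1 : ℚ) / (K : ℚ) + 1 := lt_of_le_of_lt h3 h4
      have h6 : (K : ℚ) * A < k 1 + K := by
        have := mul_lt_mul_of_pos_left h5 hKQ
        rwa [mul_add, mul_div_cancel₀ _ hKQ.ne', mul_one] at this
      exact_mod_cast h6
    simp only [Nat.sub_self, mul_zero, zero_add]
    omega

/-- **Theorem 4 of Chen–Wang–Zhang.**  Let `m, m' ≥ 1` and let
`T = 1 ^ k 1 (i 2) ^ k 2 ⋯ (i r) ^ k r` be a type with `r ≥ 2`,
`1 = i 1 < i 2 < ⋯ < i r`, all `k j ≥ 1` and `n = k 1 + ∑_{j=2}^{r} k j * i j`.  If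
`⌈k 1 / (k 2 + ⋯ + k r)⌉ ≥ (max m m' - 1) * (i r - 1)`, then there is a bijection between
the set `P_m` of `m`-AP-partitions of `ZMod n` of type `T` and the set `P_{m'}` of
`m'`-AP-partitions of `ZMod n` of type `T`; in particular `|P_m| = |P_{m'}|`. -/
theorem statement7 (m m' r : ℕ) (i k : ℕ → ℕ) (hm : 1 ≤ m) (hm' : 1 ≤ m') (hr : 2 ≤ r)
    (hi1 : i 1 = 1)
    (hmono : ∀ j, 1 ≤ j → j < r → i j < i (j + 1))
    (hk : ∀ j, 1 ≤ j → j ≤ r → 1 ≤ k j)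
    (n : ℕ) (hn : n = k 1 + ∑ j ∈ Finset.Icc 2 r, k j * i j)
    (hcond : (((max m m' - 1) * (i r - 1) : ℕ) : ℤ) ≤
      ⌈(k 1 : ℚ) / ((∑ j ∈ Finset.Icc 2 r, k j : ℕ) : ℚ)⌉) :
    Nonempty
      ({π : Finset (ZMod n × ℕ) // IsAPPartition n m π ∧ HasType n π r i k} ≃
        {π : Finset (ZMod n × ℕ) // IsAPPartition n m' π ∧ HasType n π r i k}) ∧
    {π : Finset (ZMod n × ℕ) | IsAPPartition n m π ∧ HasType n π r i k}.ncard =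
      {π : Finset (ZMod n × ℕ) | IsAPPartition n m' π ∧ HasType n π r i k}.ncard := by
  have S := setup_of (max m m') r i k hr hi1 hmono hk n hn hcond
  obtain ⟨e⟩ := nonempty_equiv S hm (le_max_left m m') hm' (le_max_right m m')
  refine ⟨⟨e⟩, ?_⟩
  rw [← Nat.card_coe_set_eq, ← Nat.card_coe_set_eq]
  exact Nat.card_congr e
end

section
/- Let m, p, k ≥ 1 and n ≥ mpk + 1. The map sending an m-AP-partition of Z_n of type 1^{n−(p+1)k} (p+1)^k to the set of heads of its k blocks of length p + 1 is a bijection from the set of such partitions onto the family of k-element subsets S of Z_n satisfying x − y ∉ {m, 2m, …, pm} (modulo n) for every ordered pair (x, y) of distinct elements of S. -/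
theorem mem_blockSet_iff' (n m : ℕ) (x z : ZMod n) (l : ℕ) :
    z ∈ blockSet n m (x, l) ↔ ∃ j < l, x + ((j * m : ℕ) : ZMod n) = z := by
  simp [blockSet]

theorem self_mem_blockSet (n m : ℕ) (b : ZMod n × ℕ) (h : 1 ≤ b.2) : b.1 ∈ blockSet n m b := by
  obtain ⟨x, l⟩ := b
  rw [mem_blockSet_iff']
  exact ⟨0, h, by simp⟩

theorem eq_of_common {n m : ℕ} {π : Finset (ZMod n × ℕ)} (h : IsAPPartition n m π)
    {b c : ZMod n × ℕ} (hb : b ∈ π) (hc : c ∈ π) {z : ZMod n}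
    (h1 : z ∈ blockSet n m b) (h2 : z ∈ blockSet n m c) : b = c := by
  by_contra hne
  exact Finset.disjoint_left.1 (h.2.1 b hb c hc hne) h1 h2

theorem sub_of_heads {n m p : ℕ} (hp : 1 ≤ p) {π ρ : Finset (ZMod n × ℕ)}
    (h1 : IsAPPartition n m π) (h2 : IsAPPartition n m ρ)
    (t1 : ∀ b ∈ π, b.2 = 1 ∨ b.2 = p + 1) (t2 : ∀ b ∈ ρ, b.2 = 1 ∨ b.2 = p + 1)
    (he : ∀ x, (x, p + 1) ∈ π ↔ (x, p + 1) ∈ ρ) : π ⊆ ρ := by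
  rintro ⟨x, l⟩ hb
  rcases t1 _ hb with h | h
  · simp only at h
    subst h
    obtain ⟨⟨y, l⟩, hc, hx⟩ := h2.2.2 x
    rcases t2 _ hc with h | h
    · simp only at h
      subst h
      rw [mem_blockSet_iff'] at hx
      obtain ⟨j, hj, e⟩ := hx
      obtain rfl : j = 0 := by omega
      simp at e
      subst e
      exact hc
    · simp only at h
      subst h
      have := eq_of_common h1 hb ((he y).2 hc) (self_mem_blockSet n m _ le_rfl) hx
      simp at this
      omega
  · simp only at h
    subst h
    exact (he x).1 hb

theorem cast_ne_of_lt {n m p i j : ℕ} (hm : 1 ≤ m) (hn : m * p < n) (hij : i < j) (hj : j ≤ p) :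
    ((i * m : ℕ) : ZMod n) ≠ ((j * m : ℕ) : ZMod n) := by
  intro h
  rw [ZMod.natCast_eq_natCast_iff'] at h
  have h1 : i * m < j * m := Nat.mul_lt_mul_of_pos_right hij hm
  have h2 : j * m ≤ p * m := Nat.mul_le_mul_right _ hj
  have h3 : p * m = m * p := mul_comm _ _
  rw [Nat.mod_eq_of_lt (by omega), Nat.mod_eq_of_lt (by omega)] at h
  omega

theorem card_block {n m p : ℕ} (hm : 1 ≤ m) (hn : m * p < n) (x : ZMod n) :
    (blockSet n m (x, p + 1)).card = p + 1 := by
  unfold blockSet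
  rw [Finset.card_image_of_injOn, Finset.card_range]
  intro i hi j hj h
  simp only [Finset.coe_range, Set.mem_Iio] at hi hj
  have h' := add_left_cancel h
  rcases lt_trichotomy i j with hl | hl | hl
  · exact absurd h' (cast_ne_of_lt hm hn hl (by omega))
  · exact hl
  · exact absurd h'.symm (cast_ne_of_lt hm hn hl (by omega))

theorem sub_eq_of_lt {n m i j : ℕ} {x y : ZMod n} (hij : i ≤ j)
    (h : x + ((i * m : ℕ) : ZMod n) = y + ((j * m : ℕ) : ZMod n)) :
    x - y = (((j - i) * m : ℕ) : ZMod n) := by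
  obtain ⟨d, rfl⟩ := Nat.exists_eq_add_of_le hij
  rw [Nat.add_sub_cancel_left]
  push_cast at h ⊢
  linear_combination h

theorem disj_blocks {n m p : ℕ} {S : Finset (ZMod n)}
    (hS : ∀ x ∈ S, ∀ y ∈ S, x ≠ y →
          ∀ a : ℕ, 1 ≤ a → a ≤ p → x - y ≠ ((a * m : ℕ) : ZMod n))
    {x y : ZMod n} (hx : x ∈ S) (hy : y ∈ S) (hne : x ≠ y) :
    Disjoint (blockSet n m (x, p + 1)) (blockSet n m (y, p + 1)) := by
  rw [Finset.disjoint_left]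
  intro z h1 h2
  rw [mem_blockSet_iff'] at h1 h2
  obtain ⟨i, hi, e1⟩ := h1
  obtain ⟨j, hj, e2⟩ := h2
  have e := e1.trans e2.symm
  rcases lt_trichotomy i j with hl | hl | hl
  · exact hS x hx y hy hne (j - i) (by omega) (by omega) (sub_eq_of_lt hl.le e)
  · subst hl
    exact hne (add_right_cancel e)
  · exact hS y hy x hx hne.symm (i - j) (by omega) (by omega) (sub_eq_of_lt hl.le e.symm)

/-- Let `m, p, k ≥ 1` and `n ≥ mpk + 1`.  The map sending an `m`-AP-partition of `ZMod n`
of type `1 ^ (n - (p+1)k) (p+1) ^ k` to the set of heads of its `k` blocks of length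
`p + 1` is a bijection from the set of such partitions onto the family of `k`-element
subsets `S` of `ZMod n` with `x - y ∉ {m, 2m, …, pm}` (modulo `n`) for every ordered pair
`(x, y)` of distinct elements of `S`. -/
theorem statement8 (m p k n : ℕ) (hm : 1 ≤ m) (hp : 1 ≤ p) (hk : 1 ≤ k)
    (hn : m * p * k + 1 ≤ n) :
    Set.BijOn
      (fun π : Finset (ZMod n × ℕ) => (π.filter fun b => b.2 = p + 1).image Prod.fst)
      {π : Finset (ZMod n × ℕ) | IsAPPartition n m π ∧
        (π.filter fun b => b.2 = 1).card = n - (p + 1) * k ∧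
        (π.filter fun b => b.2 = p + 1).card = k ∧
        ∀ b ∈ π, b.2 = 1 ∨ b.2 = p + 1}
      {S : Finset (ZMod n) | S.card = k ∧
        ∀ x ∈ S, ∀ y ∈ S, x ≠ y →
          ∀ a : ℕ, 1 ≤ a → a ≤ p → x - y ≠ ((a * m : ℕ) : ZMod n)} := by
  have hn' : m * p < n := by
    have : m * p * 1 ≤ m * p * k := Nat.mul_le_mul_left _ hk
    omega
  haveI : NeZero n := ⟨by omega⟩
  refine ⟨?_, ?_, ?_⟩
  · rintro π ⟨hπ, -, hc, -⟩
    refine ⟨?_, ?_⟩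
    · show (Finset.image _ _).card = k
      rw [Finset.card_image_of_injOn, hc]
      rintro ⟨x, l⟩ hx ⟨y, l'⟩ hy h
      simp at hx hy h
      simp [h, hx.2, hy.2]
    · intro x hx y hy hne a ha hap h
      have hx' : (x, p + 1) ∈ π := by simpa using hx
      have hy' : (y, p + 1) ∈ π := by simpa using hy
      have h1 : x ∈ blockSet n m (x, p + 1) := self_mem_blockSet n m (x, p + 1) (by simp)
      have h2 : x ∈ blockSet n m (y, p + 1) := by
        rw [mem_blockSet_iff']
        exact ⟨a, by omega, by rw [← h]; ring⟩
      have := eq_of_common hπ hx' hy' h1 h2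
      simp at this
      exact hne this
  · rintro π ⟨h1, -, -, t1⟩ ρ ⟨h2, -, -, t2⟩ h
    have he : ∀ x, (x, p + 1) ∈ π ↔ (x, p + 1) ∈ ρ := by
      intro x
      have := Finset.ext_iff.1 h x
      simpa using this
    exact Finset.Subset.antisymm (sub_of_heads hp h1 h2 t1 t2 he)
      (sub_of_heads hp h2 h1 t2 t1 fun x => (he x).symm)
  · rintro S ⟨hc, hS⟩
    set U : Finset (ZMod n) := S.biUnion fun x => blockSet n m (x, p + 1) with hU
    have hUc : U.card = k * (p + 1) := by
      rw [hU, Finset.card_biUnion (fun x hx y hy hne => disj_blocks hS hx hy hne),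
        Finset.sum_congr rfl (fun x _ => card_block hm hn' x)]
      simp [hc]
    set A : Finset (ZMod n × ℕ) := S.image fun x => (x, p + 1) with hA
    set B : Finset (ZMod n × ℕ) := Uᶜ.image fun x => (x, 1) with hB
    have mA : ∀ x l, (x, l) ∈ A ↔ x ∈ S ∧ l = p + 1 := by
      intro x l; simp [hA, eq_comm]
    have mB : ∀ x l, (x, l) ∈ B ↔ x ∉ U ∧ l = 1 := by
      intro x l
      simp only [hB, Finset.mem_image, Finset.mem_compl, Prod.mk.injEq]
      constructor
      · rintro ⟨a, h, rfl, rfl⟩; exact ⟨h, rfl⟩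
      · rintro ⟨h, rfl⟩; exact ⟨x, h, rfl, rfl⟩
    have fA : ((A ∪ B).filter fun b => b.2 = p + 1) = A := by
      ext ⟨x, l⟩
      simp only [Finset.mem_filter, Finset.mem_union, mA, mB]
      constructor
      · rintro ⟨h | h, h'⟩
        · exact h
        · omega
      · intro h; exact ⟨Or.inl h, h.2⟩
    have fB : ((A ∪ B).filter fun b => b.2 = 1) = B := by
      ext ⟨x, l⟩
      simp only [Finset.mem_filter, Finset.mem_union, mA, mB]
      constructor
      · rintro ⟨h | h, h'⟩
        · omega
        · exact h
      · intro h; exact ⟨Or.inr h, h.2⟩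
    have single : ∀ x z : ZMod n, z ∈ blockSet n m (x, 1) ↔ z = x := by
      intro x z
      simp [blockSet]
    have dAB : ∀ x ∈ S, ∀ y, y ∉ U →
        Disjoint (blockSet n m (x, p + 1)) (blockSet n m (y, 1)) := by
      intro x hx y hy
      rw [Finset.disjoint_left]
      intro z h1 h2
      rw [single] at h2
      subst h2
      exact hy (Finset.mem_biUnion.2 ⟨x, hx, h1⟩)
    refine ⟨A ∪ B, ⟨⟨?_, ?_, ?_⟩, ?_, ?_, ?_⟩, ?_⟩
    · rintro ⟨x, l⟩ h
      rw [Finset.mem_union, mA, mB] at h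
      show 1 ≤ l
      omega
    · rintro ⟨x, l⟩ h ⟨y, l'⟩ h' hne
      rw [Finset.mem_union, mA, mB] at h h'
      rcases h with ⟨hx, rfl⟩ | ⟨hx, rfl⟩ <;> rcases h' with ⟨hy, rfl⟩ | ⟨hy, rfl⟩
      · exact disj_blocks hS hx hy (fun e => hne (by rw [e]))
      · exact dAB x hx y hy
      · exact (dAB y hy x hx).symm
      · rw [Finset.disjoint_left]
        intro z h1 h2
        rw [single] at h1 h2
        exact hne (by rw [← h1, ← h2])
    · intro z
      by_cases hz : z ∈ U
      · obtain ⟨x, hx, h⟩ := Finset.mem_biUnion.1 hz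
        exact ⟨(x, p + 1), Finset.mem_union_left _ ((mA _ _).2 ⟨hx, rfl⟩), h⟩
      · exact ⟨(z, 1), Finset.mem_union_right _ ((mB _ _).2 ⟨hz, rfl⟩), (single _ _).2 rfl⟩
    · rw [fB, hB, Finset.card_image_of_injective _ (fun x y h => (Prod.mk.inj h).1),
        Finset.card_compl, hUc, ZMod.card, mul_comm]
    · rw [fA, hA, Finset.card_image_of_injective _ (fun x y h => (Prod.mk.inj h).1), hc]
    · rintro ⟨x, l⟩ h
      rw [Finset.mem_union, mA, mB] at h
      show l = 1 ∨ l = p + 1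
      omega
    · show Finset.image _ _ = S
      rw [fA, hA, Finset.image_image]
      ext x
      simp
end
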